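/- arXiv:2001.09597 — 2 statements merged into one kernel-verified Lean document; each statement's English description precedes it below -/
import Mathlib

section
/- A finite soluble group G is totally 2-closed if and only if G is cyclic or isomorphic to the direct product of a cyclic group of odd order with a generalized quaternion group. -/
def twoClosure {Ω : Type*} (H : Subgroup (Equiv.Perm Ω)) : Subgroup (Equiv.Perm Ω) where
  carrier := {θ | ∀ α β : Ω, ∃ h ∈ H, θ α = h α ∧ θ β = h β}
  one_mem' := fun α β => ⟨1, H.one_mem, rfl, rfl⟩
  mul_mem' := by
    intro a b ha hb α β
    obtain ⟨h₂, h₂H, e1, e2⟩ := hb α β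
    obtain ⟨h₁, h₁H, f1, f2⟩ := ha (b α) (b β)
    refine ⟨h₁ * h₂, H.mul_mem h₁H h₂H, ?_, ?_⟩
    · simp only [Equiv.Perm.mul_apply]; rw [f1, e1]
    · simp only [Equiv.Perm.mul_apply]; rw [f2, e2]
  inv_mem' := by
    intro a ha α β
    obtain ⟨h, hH, e1, e2⟩ := ha (a⁻¹ α) (a⁻¹ β)
    refine ⟨h⁻¹, H.inv_mem hH, ?_, ?_⟩
    · have h1 : h (a⁻¹ α) = α := by rw [← e1]; simp
      exact Equiv.Perm.eq_inv_iff_eq.mpr h1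
    · have h2 : h (a⁻¹ β) = β := by rw [← e2]; simp
      exact Equiv.Perm.eq_inv_iff_eq.mpr h2

def IsTotally2Closed (G : Type*) [Group G] : Prop :=
  ∀ (Ω : Type*) (H : Subgroup (Equiv.Perm Ω)), Nonempty (G ≃* H) → twoClosure H = H

def IsGeneralizedQuaternion (Q : Type*) [Group Q] : Prop :=
  ∃ m : ℕ, 1 ≤ m ∧ Nonempty (Q ≃* QuaternionGroup (2 ^ m))

def IsFittingSubgroup {G : Type*} [Group G] (F : Subgroup G) : Prop :=
  F.Normal ∧ Group.IsNilpotent F ∧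
    ∀ N : Subgroup G, N.Normal → Group.IsNilpotent N → N ≤ F

def IsMinimalNormal {X : Type*} [Group X] (M : Subgroup X) : Prop :=
  M.Normal ∧ M ≠ ⊥ ∧ ∀ N : Subgroup X, N.Normal → N ≤ M → N = ⊥ ∨ N = M

universe u v

theorem mulSingle_mem_zpowers {ι : Type*} [Fintype ι] [DecidableEq ι] (p : ι → ℕ) (hp : ∀ i, (p i).Prime)
    (hinj : Function.Injective p) (v : ι → ℕ) (P : ι → Type*) [∀ i, Group (P i)]
    (hP : ∀ i (x : P i), x ^ (p i ^ v i) = 1) (s : ∀ i, P i) (i : ι) :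
    Pi.mulSingle i (s i) ∈ Subgroup.zpowers s := by
  have hc : Nat.Coprime (p i ^ v i) (∏ j ∈ Finset.univ.erase i, p j ^ v j) := by
    apply Nat.Coprime.prod_right
    intro j hj
    apply Nat.Coprime.pow
    rw [Nat.coprime_primes (hp i) (hp j)]
    intro h
    exact (Finset.ne_of_mem_erase hj) (hinj h).symm
  obtain ⟨c, h1, h2⟩ := Nat.chineseRemainder hc 1 0
  refine ⟨(c : ℤ), ?_⟩
  simp only [zpow_natCast]
  funext j
  by_cases hj : j = i
  · subst hj
    simp only [Pi.pow_apply, Pi.mulSingle_eq_same]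
    have : s j ^ c = s j ^ 1 := by
      rw [pow_eq_pow_iff_modEq]
      exact h1.of_dvd (orderOf_dvd_of_pow_eq_one (hP j _))
    simpa using this
  · simp only [Pi.pow_apply]
    rw [Pi.mulSingle_eq_of_ne hj]
    have hd : p j ^ v j ∣ c := by
      refine dvd_trans ?_ ((Nat.modEq_zero_iff_dvd).1 h2)
      exact Finset.dvd_prod_of_mem (fun j => p j ^ v j) (Finset.mem_erase.2 ⟨hj, Finset.mem_univ _⟩)
    obtain ⟨d, rfl⟩ := hd
    rw [pow_mul, hP, one_pow]

theorem backward_pi {ι : Type*} [Fintype ι] [DecidableEq ι] (p : ι → ℕ) (hp : ∀ i, (p i).Prime)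
    (hinj : Function.Injective p) (v : ι → ℕ) (P : ι → Type*) [∀ i, Group (P i)]
    (hP : ∀ i (x : P i), x ^ (p i ^ v i) = 1)
    (hz : ∀ i, ∃ z : ∀ i, P i, orderOf z = p i)
    (hu : ∀ i (x y : ∀ i, P i), orderOf x = p i → orderOf y = p i → y ∈ Subgroup.zpowers x)
    {Ω : Type*} [MulAction (∀ i, P i) Ω] [FaithfulSMul (∀ i, P i) Ω] (θ : Ω → Ω)
    (h : ∀ α β, ∃ g : ∀ i, P i, θ α = g • α ∧ θ β = g • β) : ∃ g : ∀ i, P i, ∀ α, θ α = g • α := by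
  have h1 : ∀ i, ∃ α : Ω, ∀ x : ∀ i, P i, x • α = α → x i = 1 := by
    intro i
    obtain ⟨z, hz⟩ := hz i
    have hz1 : ∃ α : Ω, z • α ≠ α := by
      by_contra hcon
      push Not at hcon
      have : z = 1 := FaithfulSMul.eq_of_smul_eq_smul (α := Ω) (by simpa using hcon)
      subst this
      rw [orderOf_one] at hz
      exact (hp i).ne_one hz.symm
    obtain ⟨α, hα⟩ := hz1
    refine ⟨α, fun x hx => ?_⟩
    by_contra hne
    apply hα
    set y : ∀ i, P i := Pi.mulSingle i (x i) with hy
    have hyx : y ∈ Subgroup.zpowers x := mulSingle_mem_zpowers p hp hinj v P hP x i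
    have hy1 : y ≠ 1 := by
      intro h; apply hne
      have := congrFun h i
      simpa [hy] using this
    have hyp : y ^ (p i ^ v i) = 1 := by
      rw [hy, ← Pi.mulSingle_pow, hP, Pi.mulSingle_one]
    have hyd := orderOf_dvd_of_pow_eq_one hyp
    have hpo : p i ∣ orderOf y := by
      obtain ⟨k, -, hk⟩ := (Nat.dvd_prime_pow (hp i)).1 hyd
      rw [hk]
      apply dvd_pow_self
      rintro rfl
      exact hy1 (orderOf_eq_one_iff.1 (by simpa using hk))
    have hpos : orderOf y ≠ 0 := by
      intro h0
      rw [h0, zero_dvd_iff] at hyd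
      exact (pow_pos (hp i).pos _).ne' hyd
    have ho : orderOf (y ^ (orderOf y / p i)) = p i := orderOf_pow_orderOf_div hpos hpo
    have hzm := hu i _ _ ho hz
    have : z ∈ MulAction.stabilizer (∀ i, P i) α := by
      have hxs : x ∈ MulAction.stabilizer (∀ i, P i) α := hx
      have hys : y ∈ MulAction.stabilizer (∀ i, P i) α := (Subgroup.zpowers_le.2 hxs) hyx
      exact (Subgroup.zpowers_le.2 (Subgroup.pow_mem _ hys _)) hzm
    exact this
  choose a ha using h1
  choose b hb using fun i => h (a i) (a i)
  refine ⟨fun i => b i i, fun β => ?_⟩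
  set g : ∀ i, P i := fun i => b i i with hg
  obtain ⟨k, hk, -⟩ := h β β
  rw [hk]
  have hst : ∀ i, Pi.mulSingle i ((g⁻¹ * k) i) ∈ MulAction.stabilizer (∀ i, P i) β := by
    intro i
    obtain ⟨c, hc1, hc2⟩ := h (a i) β
    have hci : c i = g i := by
      have : ((b i)⁻¹ * c) • a i = a i := by
        rw [mul_smul, ← hc1, (hb i).1, inv_smul_smul]
      have := ha i _ this
      simp only [Pi.mul_apply, Pi.inv_apply, inv_mul_eq_one] at this
      exact this.symm
    have hs : c⁻¹ * k ∈ MulAction.stabilizer (∀ i, P i) β := by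
      rw [MulAction.mem_stabilizer_iff, mul_smul, ← hk, hc2, inv_smul_smul]
    have := (Subgroup.zpowers_le.2 hs) (mulSingle_mem_zpowers p hp hinj v P hP (c⁻¹ * k) i)
    simpa [hci] using this
  have hall : g⁻¹ * k ∈ MulAction.stabilizer (∀ i, P i) β := by
    have : ∀ f : ∀ i, P i, (∀ i, Pi.mulSingle i (f i) ∈ MulAction.stabilizer (∀ i, P i) β) →
        f ∈ MulAction.stabilizer (∀ i, P i) β := by
      intro f hf
      exact Subgroup.pi_mem_of_mulSingle_mem f hf
    exact this _ hst
  rw [MulAction.mem_stabilizer_iff, mul_smul, inv_smul_eq_iff] at hall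
  exact hall

theorem backward {X : Type*} [Group X] [Finite X] [Group.IsNilpotent X]
    (hu : ∀ p : ℕ, p.Prime → ∀ x y : X, orderOf x = p → orderOf y = p → y ∈ Subgroup.zpowers x)
    {Ω : Type*} [MulAction X Ω] [FaithfulSMul X Ω] (θ : Ω → Ω)
    (h : ∀ α β, ∃ g : X, θ α = g • α ∧ θ β = g • β) : ∃ g : X, ∀ α, θ α = g • α := by
  classical
  have htf := (Group.isNilpotent_of_finite_tfae (G := X)).out 0 4
  obtain ⟨e⟩ := htf.1 inferInstance
  let I := (Nat.card X).primeFactors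
  let Y := ∀ p : I, ∀ P : Sylow p X, P
  let _ : MulAction Y Ω := MulAction.compHom Ω e.toMonoidHom
  have hsm : ∀ (y : Y) (α : Ω), y • α = e y • α := fun _ _ => rfl
  have hf : FaithfulSMul Y Ω := ⟨fun {x y} hxy => e.injective
    (FaithfulSMul.eq_of_smul_eq_smul (α := Ω) (fun a => by simpa [hsm] using hxy a))⟩
  have hpr : ∀ i : I, (i : ℕ).Prime := fun i => Nat.prime_of_mem_primeFactors i.2
  obtain ⟨g, hg⟩ := backward_pi (ι := I) (fun i => (i : ℕ)) hpr Subtype.val_injective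
    (fun i => (Nat.card X).factorization i) (fun p => ∀ P : Sylow p X, P)
    (by
      intro i x
      funext P
      have : Fact ((i : ℕ).Prime) := ⟨hpr i⟩
      simp only [Pi.pow_apply, Pi.one_apply]
      rw [← Sylow.card_eq_multiplicity P]
      exact pow_card_eq_one')
    (by
      intro i
      have : Fact ((i : ℕ).Prime) := ⟨hpr i⟩
      obtain ⟨z, hz⟩ := exists_prime_orderOf_dvd_card' (G := X) (i : ℕ) (Nat.dvd_of_mem_primeFactors i.2)
      exact ⟨e.symm z, by rw [MulEquiv.orderOf_eq]; exact hz⟩)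
    (by
      intro i x y hx hy
      obtain ⟨k, hk⟩ := hu i (hpr i) (e x) (e y) (by rw [MulEquiv.orderOf_eq]; exact hx)
        (by rw [MulEquiv.orderOf_eq]; exact hy)
      refine ⟨k, e.injective ?_⟩
      simpa using hk)
    θ (fun α β => by
      obtain ⟨g, hg⟩ := h α β
      exact ⟨e.symm g, by simpa [hsm] using hg⟩)
  exact ⟨e g, hg⟩

theorem t2c_of_unique {X : Type*} [Group X] [Finite X] [Group.IsNilpotent X]
    (hu : ∀ p : ℕ, p.Prime → ∀ x y : X, orderOf x = p → orderOf y = p → y ∈ Subgroup.zpowers x) :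
    IsTotally2Closed X := by
  rintro Ω H ⟨e⟩
  apply le_antisymm
  · intro θ hθ
    let _ : MulAction X Ω := MulAction.compHom Ω (H.subtype.comp e.toMonoidHom)
    have hsm : ∀ (y : X) (α : Ω), y • α = (e y : Equiv.Perm Ω) α := fun _ _ => rfl
    have hf : FaithfulSMul X Ω := ⟨fun {x y} hxy => by
      apply e.injective
      apply Subtype.ext
      apply Equiv.ext
      intro a
      simpa [hsm] using hxy a⟩
    obtain ⟨g, hg⟩ := backward hu (θ : Ω → Ω) (fun α β => by
      obtain ⟨k, hk, h1, h2⟩ := hθ α β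
      exact ⟨e.symm ⟨k, hk⟩, by simpa [hsm] using ⟨h1, h2⟩⟩)
    have : θ = e g := Equiv.ext hg
    rw [this]
    exact (e g).2
  · intro θ hθ α β
    exact ⟨θ, hθ, rfl, rfl⟩

theorem unique_of_cyclic {X : Type*} [Group X] [Finite X] [IsCyclic X] (p : ℕ) (hp : 0 < p) (x y : X)
    (hx : orderOf x = p) (hy : y ^ p = 1) : y ∈ Subgroup.zpowers x := by
  classical
  have := Fintype.ofFinite X
  have h1 := IsCyclic.card_pow_eq_one_le (α := X) hp
  have h2 : (Finset.univ.filter (fun a : X => a ∈ Subgroup.zpowers x)) ⊆ Finset.univ.filter (fun a : X => a ^ p = 1) := by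
    intro a ha
    simp only [Finset.mem_filter, Finset.mem_univ, true_and] at ha ⊢
    obtain ⟨k, rfl⟩ := ha
    simp only
    rw [← zpow_natCast, ← zpow_mul, mul_comm, zpow_mul, zpow_natCast, ← hx, pow_orderOf_eq_one, one_zpow]
  have h3 : (Finset.univ.filter (fun a : X => a ∈ Subgroup.zpowers x)).card = p := by
    rw [← hx, ← Nat.card_zpowers, Nat.card_eq_fintype_card, Fintype.card_subtype]
  have h4 := Finset.eq_of_subset_of_card_le h2 (by rw [h3]; exact h1)
  have : y ∈ Finset.univ.filter (fun a : X => a ^ p = 1) := by simpa using hy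
  rw [← h4] at this
  simpa using this

theorem t2c_of_cyclic {X : Type*} [Group X] [Finite X] [IsCyclic X] : IsTotally2Closed X := by
  have : Group.IsNilpotent X := by
    let _ : CommGroup X := IsCyclic.commGroup
    infer_instance
  apply t2c_of_unique
  intro p hp x y hx hy
  exact unique_of_cyclic p hp.pos x y hx (by rw [← hy, pow_orderOf_eq_one])

theorem quat_invol (m : ℕ) (b : QuaternionGroup (2 ^ m)) (hb : b ^ 2 = 1) (hb1 : b ≠ 1) :
    b = QuaternionGroup.a ((2 ^ m : ℕ) : ZMod (2 * 2 ^ m)) := by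
  have : NeZero (2 ^ m) := ⟨by positivity⟩
  rcases b with i | i
  · rw [sq, QuaternionGroup.a_mul_a, QuaternionGroup.one_def] at hb
    rw [QuaternionGroup.one_def] at hb1
    injection hb with hb
    congr 1
    have hi : i ≠ 0 := fun h => hb1 (by rw [h])
    obtain ⟨k, rfl⟩ := ZMod.natCast_zmod_surjective i
    have hb' : ((k + k : ℕ) : ZMod (2 * 2 ^ m)) = 0 := by push_cast; exact hb
    rw [ZMod.natCast_eq_zero_iff] at hb'
    have hk : 2 ^ m ∣ k := by
      rw [← two_mul] at hb'
      exact Nat.dvd_of_mul_dvd_mul_left (by norm_num) hb'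
    obtain ⟨c, rfl⟩ := hk
    rw [Ne, ZMod.natCast_eq_zero_iff] at hi
    rw [ZMod.natCast_eq_natCast_iff]
    have hc : c % 2 = 1 := by
      by_contra h
      have : 2 ∣ c := by omega
      obtain ⟨d, rfl⟩ := this
      exact hi ⟨d, by ring⟩
    have : c = 1 + 2 * (c / 2) := by omega
    rw [this, Nat.ModEq, mul_add, mul_one, ← mul_assoc, mul_comm (2 ^ m) 2, Nat.add_mul_mod_self_left]
  · exfalso
    have h4 := QuaternionGroup.orderOf_xa i
    have h5 := orderOf_dvd_of_pow_eq_one hb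
    rw [h4] at h5
    omega

theorem t2c_of_quat {X : Type*} [Group X] [Finite X] (n m : ℕ) (hn : Odd n)
    (e : X ≃* (Multiplicative (ZMod n) × QuaternionGroup (2 ^ m))) : IsTotally2Closed X := by
  have : NeZero (2 ^ m) := ⟨by positivity⟩
  have : NeZero n := ⟨by rintro rfl; simp at hn⟩
  have h2 : Fact (Nat.Prime 2) := ⟨Nat.prime_two⟩
  have hcard : Nat.card (QuaternionGroup (2 ^ m)) = 2 ^ (m + 2) := by
    rw [Nat.card_eq_fintype_card, QuaternionGroup.card]; ring
  have hq : Group.IsNilpotent (QuaternionGroup (2 ^ m)) := 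
    IsPGroup.isNilpotent (p := 2) (IsPGroup.of_card (n := m + 2) hcard)
  have hX : Group.IsNilpotent X := by
    have hP : Group.IsNilpotent (Multiplicative (ZMod n) × QuaternionGroup (2 ^ m)) := inferInstance
    exact (Group.isNilpotent_congr e).2 hP
  apply t2c_of_unique
  intro p hp x y hx hy
  suffices h : ∀ x y : Multiplicative (ZMod n) × QuaternionGroup (2 ^ m), orderOf x = p → orderOf y = p →
      y ∈ Subgroup.zpowers x by
    obtain ⟨k, hk⟩ := h (e x) (e y) (by rw [MulEquiv.orderOf_eq]; exact hx)
        (by rw [MulEquiv.orderOf_eq]; exact hy)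
    exact ⟨k, e.injective (by simpa using hk)⟩
  clear hx hy x y
  have hpw : ∀ x : Multiplicative (ZMod n) × QuaternionGroup (2 ^ m), orderOf x = p → x ^ p = 1 := by
    intro x hx; rw [← hx, pow_orderOf_eq_one]
  rintro ⟨a, b⟩ ⟨a', b'⟩ hx hy
  have hx1 := hpw _ hx
  have hy1 := hpw _ hy
  simp only [Prod.pow_mk, Prod.mk_eq_one] at hx1 hy1
  rcases hp.eq_two_or_odd' with rfl | hodd
  · have ha : ∀ a : Multiplicative (ZMod n), a ^ 2 = 1 → a = 1 := by
      intro a h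
      have h3 := orderOf_dvd_of_pow_eq_one h
      have h4 : orderOf a ∣ n := by
        have := orderOf_dvd_natCard a
        simpa using this
      have h5 := Nat.dvd_gcd h3 h4
      rw [(Nat.coprime_two_left).2 hn] at h5
      exact orderOf_eq_one_iff.1 (Nat.dvd_one.1 h5)
    have ea := ha _ hx1.1
    have ea' := ha _ hy1.1
    subst ea ea'
    have hb : b ≠ 1 := by rintro rfl; rw [← Prod.one_eq_mk, orderOf_one] at hx; omega
    have hb' : b' ≠ 1 := by rintro rfl; rw [← Prod.one_eq_mk, orderOf_one] at hy; omega
    rw [quat_invol m b hx1.2 hb, quat_invol m b' hy1.2 hb']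
    exact Subgroup.mem_zpowers _
  · have hb : ∀ b : QuaternionGroup (2 ^ m), b ^ p = 1 → b = 1 := by
      intro b h
      have h3 := orderOf_dvd_of_pow_eq_one h
      have h4 : orderOf b ∣ 2 ^ (m + 2) := hcard ▸ orderOf_dvd_natCard b
      have h5 := Nat.dvd_gcd h3 h4
      have : Nat.Coprime p (2 ^ (m + 2)) := Nat.Coprime.pow_right _ ((Nat.coprime_two_right).2 hodd)
      rw [this] at h5
      exact orderOf_eq_one_iff.1 (Nat.dvd_one.1 h5)
    have ea := hb _ hx1.2
    have ea' := hb _ hy1.2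
    subst ea ea'
    rw [Prod.orderOf, orderOf_one] at hx
    obtain ⟨k, hk⟩ := unique_of_cyclic p hp.pos a a' (by simpa using hx) hy1.1
    refine ⟨k, ?_⟩
    ext1
    · simpa using hk
    · simp

def GoodT2 (G : Type u) [Group G] : Prop :=
  ∀ (Ω : Type u) [Finite Ω] [MulAction G Ω] [FaithfulSMul G Ω] (θ : Equiv.Perm Ω),
    (∀ α β, ∃ g : G, θ α = g • α ∧ θ β = g • β) → ∃ g : G, ∀ α, θ α = g • α

theorem goodT2_of_t2c {G : Type u} [Group G] (hG : IsTotally2Closed.{u, v} G) : GoodT2 G := by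
  intro Ω _ _ _ θ hθ
  obtain ⟨n, ⟨f0⟩⟩ := Finite.exists_equiv_fin Ω
  let f : Ω ≃ ULift.{v} (Fin n) := f0.trans Equiv.ulift.symm
  let φ : G →* Equiv.Perm (ULift.{v} (Fin n)) := (f.permCongrHom.toMonoidHom).comp (MulAction.toPermHom G Ω)
  have hφ : Function.Injective φ := by
    have h1 : Function.Injective (MulAction.toPermHom G Ω) := MulAction.toPerm_injective
    exact f.permCongrHom.injective.comp h1
  have hφa : ∀ g x, φ g x = f (g • f.symm x) := fun g x => rfl
  have key := hG _ φ.range ⟨MonoidHom.ofInjective hφ⟩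
  have hmem : f.permCongr θ ∈ twoClosure φ.range := by
    intro α β
    obtain ⟨g, h1, h2⟩ := hθ (f.symm α) (f.symm β)
    exact ⟨φ g, ⟨g, rfl⟩, by simp [hφa, h1], by simp [hφa, h2]⟩
  rw [key] at hmem
  obtain ⟨g, hg⟩ := hmem
  refine ⟨g, fun α => ?_⟩
  have := congrArg (fun t => f.symm (t (f α))) hg
  simpa [hφa] using this.symm

theorem GoodT2.congr {G G' : Type u} [Group G] [Group G'] (hG : GoodT2 G) (e : G ≃* G') : GoodT2 G' := by
  intro Ω _ _ _ θ hθ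
  let _ : MulAction G Ω := MulAction.compHom Ω e.toMonoidHom
  have hsm : ∀ (y : G) (α : Ω), y • α = e y • α := fun _ _ => rfl
  have hf : FaithfulSMul G Ω := ⟨fun {x y} hxy => e.injective
    (FaithfulSMul.eq_of_smul_eq_smul (α := Ω) (fun a => by simpa [hsm] using hxy a))⟩
  obtain ⟨g, hg⟩ := hG Ω θ (fun α β => by
    obtain ⟨g, h1, h2⟩ := hθ α β
    exact ⟨e.symm g, by simpa [hsm] using ⟨h1, h2⟩⟩)
  exact ⟨e g, hg⟩

theorem GoodT2.fst {A B : Type u} [Group A] [Group B] [Finite B] (hG : GoodT2 (A × B)) : GoodT2 A := by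
  intro Ω _ _ _ θ hθ
  let _ : MulAction (A × B) Ω := MulAction.compHom Ω (MonoidHom.fst A B)
  let _ : MulAction (A × B) B := MulAction.compHom B (MonoidHom.snd A B)
  have hs1 : ∀ (y : A × B) (α : Ω), y • α = y.1 • α := fun _ _ => rfl
  have hs2 : ∀ (y : A × B) (α : B), y • α = y.2 * α := fun _ _ => rfl
  have hf : FaithfulSMul (A × B) (Ω ⊕ B) := ⟨fun {x y} hxy => by
    ext1
    · apply FaithfulSMul.eq_of_smul_eq_smul (α := Ω)
      intro a
      have := hxy (Sum.inl a)
      simpa [hs1] using this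
    · have := hxy (Sum.inr 1)
      simpa [hs2] using this⟩
  obtain ⟨g, hg⟩ := hG (Ω ⊕ B) (Equiv.sumCongr θ (Equiv.refl B)) (by
    have h1 : ∀ α β, ∃ g : A, (Equiv.sumCongr θ (Equiv.refl B)) α = (g, (1 : B)) • α ∧
        (Equiv.sumCongr θ (Equiv.refl B)) β = (g, (1 : B)) • β := by
      rintro (α | α) (β | β)
      · obtain ⟨g, h1, h2⟩ := hθ α β
        exact ⟨g, by simp [hs1, h1, h2]⟩
      · obtain ⟨g, h1, h2⟩ := hθ α α
        exact ⟨g, by simp [hs1, hs2, h1]⟩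
      · obtain ⟨g, h1, h2⟩ := hθ β β
        exact ⟨g, by simp [hs1, hs2, h1]⟩
      · exact ⟨1, by simp [hs2]⟩
    intro α β
    obtain ⟨g, h⟩ := h1 α β
    exact ⟨_, h⟩)
  refine ⟨g.1, fun α => ?_⟩
  have := hg (Sum.inl α)
  simpa [hs1] using this

theorem GoodT2.switch {G : Type u} [Group G] (hG : GoodT2 G) (Ω : Type u) [Finite Ω] [MulAction G Ω]
    [FaithfulSMul G Ω] (Δ : Set Ω) (e : G) (he : ∀ α, e • α ∈ Δ ↔ α ∈ Δ)
    (h : ∀ α ∈ Δ, ∀ β ∉ Δ, ∃ g : G, g • α = e • α ∧ g • β = β) :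
    ∃ g : G, (∀ α ∈ Δ, g • α = e • α) ∧ ∀ β ∉ Δ, g • β = β := by
  classical
  have he' : ∀ α, e⁻¹ • α ∈ Δ ↔ α ∈ Δ := fun α => by rw [← he, smul_inv_smul]
  let θ : Equiv.Perm Ω :=
    { toFun := fun α => if α ∈ Δ then e • α else α
      invFun := fun α => if α ∈ Δ then e⁻¹ • α else α
      left_inv := by
        intro α
        by_cases hα : α ∈ Δ <;> simp [hα, he]
      right_inv := by
        intro α
        by_cases hα : α ∈ Δ <;> simp [hα, he'] }
  have t1 : ∀ α ∈ Δ, θ α = e • α := fun α hα => if_pos hα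
  have t2 : ∀ α ∉ Δ, θ α = α := fun α hα => if_neg hα
  obtain ⟨g, hg⟩ := hG Ω θ (by
    intro α β
    by_cases hα : α ∈ Δ <;> by_cases hβ : β ∈ Δ
    · exact ⟨e, t1 α hα, t1 β hβ⟩
    · obtain ⟨g, h1, h2⟩ := h α hα β hβ
      exact ⟨g, by rw [t1 α hα, h1], by rw [t2 β hβ, h2]⟩
    · obtain ⟨g, h1, h2⟩ := h β hβ α hα
      exact ⟨g, by rw [t2 α hα, h2], by rw [t1 β hβ, h1]⟩
    · exact ⟨1, by rw [t2 α hα, one_smul], by rw [t2 β hβ, one_smul]⟩)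
  exact ⟨g, fun α hα => by rw [← hg, t1 α hα], fun α hα => by rw [← hg, t2 α hα]⟩

theorem mem_core_of_fix {G : Type u} [Group G] (H : Subgroup G) (g : G)
    (h : ∀ x : G ⧸ H, g • x = x) : g ∈ H.normalCore := by
  rw [Subgroup.normalCore_eq_ker, MonoidHom.mem_ker]
  ext x
  simpa using h x

theorem GoodT2.factor {G : Type u} [Group G] [Finite G] (hG : GoodT2 G) (H K : Subgroup G)
    (hHK : ∀ g : G, ∃ k ∈ K, ∃ h ∈ H, g = k * h) (hc : H.normalCore ⊓ K.normalCore = ⊥) (e : G) :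
    ∃ k ∈ K.normalCore, ∃ h ∈ H.normalCore, e = k * h := by
  have hf : FaithfulSMul G ((G ⧸ H) ⊕ (G ⧸ K)) := ⟨fun {x y} hxy => by
    have h1 : y⁻¹ * x ∈ H.normalCore := mem_core_of_fix _ _ (fun a => by
      have := hxy (Sum.inl a)
      simp only [Sum.smul_inl, Sum.inl.injEq] at this
      rw [mul_smul, this, inv_smul_smul])
    have h2 : y⁻¹ * x ∈ K.normalCore := mem_core_of_fix _ _ (fun a => by
      have := hxy (Sum.inr a)
      simp only [Sum.smul_inr, Sum.inr.injEq] at this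
      rw [mul_smul, this, inv_smul_smul])
    have h3 : y⁻¹ * x ∈ H.normalCore ⊓ K.normalCore := ⟨h1, h2⟩
    rw [hc, Subgroup.mem_bot, inv_mul_eq_one] at h3
    exact h3.symm⟩
  obtain ⟨g, h1, h2⟩ := hG.switch ((G ⧸ H) ⊕ (G ⧸ K)) (Set.range Sum.inl) e (by
      rintro (α | α) <;> simp)
    (by
      rintro _ ⟨α, rfl⟩ (β | β) hβ
      · exact absurd ⟨β, rfl⟩ hβ
      · induction α using QuotientGroup.induction_on with | H x => ?_
        induction β using QuotientGroup.induction_on with | H y => ?_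
        obtain ⟨k1, hk1, h1, hh1, e1⟩ := hHK (y⁻¹ * x)
        obtain ⟨k2, hk2, h2, hh2, e2⟩ := hHK (y⁻¹ * e * x)
        refine ⟨y * k2 * k1⁻¹ * y⁻¹, ?_, ?_⟩
        · simp only [Sum.smul_inl, Sum.inl.injEq, MulAction.Quotient.smul_coe, smul_eq_mul]
          rw [QuotientGroup.eq]
          have hx : x = y * (k1 * h1) := by rw [← e1]; group
          have hx2 : e * x = y * (k2 * h2) := by rw [← e2]; group
          have : (y * k2 * k1⁻¹ * y⁻¹ * x)⁻¹ * (e * x) = h1⁻¹ * h2 := by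
            rw [hx2, hx]; group
          rw [this]
          exact H.mul_mem (H.inv_mem hh1) hh2
        · simp only [Sum.smul_inr, Sum.inr.injEq, MulAction.Quotient.smul_coe, smul_eq_mul]
          rw [QuotientGroup.eq]
          have : (y * k2 * k1⁻¹ * y⁻¹ * y)⁻¹ * y = k1 * k2⁻¹ := by group
          rw [this]
          exact K.mul_mem hk1 (K.inv_mem hk2))
  refine ⟨g, mem_core_of_fix _ _ (fun a => ?_), g⁻¹ * e, mem_core_of_fix _ _ (fun a => ?_), by group⟩
  · have := h2 (Sum.inr a) (by simp)
    simpa using this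
  · have := h1 (Sum.inl a) ⟨a, rfl⟩
    simp only [Sum.smul_inl, Sum.inl.injEq] at this
    rw [mul_smul, ← this, inv_smul_smul]

theorem exists_normal_abelian {G : Type u} [Group G] [Group.IsSolvable G] [Nontrivial G] :
    ∃ A : Subgroup G, A.Normal ∧ A ≠ ⊥ ∧ ∀ x ∈ A, ∀ y ∈ A, x * y = y * x := by
  classical
  have hs : ∃ n, derivedSeries G n = ⊥ := Group.IsSolvable.solvable
  have h0 : Nat.find hs ≠ 0 := by
    intro h
    have := Nat.find_spec hs
    rw [h, derivedSeries_zero] at this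
    exact top_ne_bot this
  obtain ⟨n, hn⟩ := Nat.exists_eq_succ_of_ne_zero h0
  refine ⟨derivedSeries G n, derivedSeries_normal G n, Nat.find_min hs (by omega), ?_⟩
  have h1 : derivedSeries G (n + 1) = ⊥ := by
    have := Nat.find_spec hs
    rwa [hn] at this
  rw [derivedSeries_succ, Subgroup.commutator_eq_bot_iff_le_centralizer] at h1
  intro x hx y hy
  exact (Subgroup.mem_centralizer_iff.1 (h1 hx) y hy).symm

theorem exists_normal_pgroup {G : Type u} [Group G] [Finite G] [Group.IsSolvable G] [Nontrivial G] :
    ∃ (q : ℕ) (N : Subgroup G), q.Prime ∧ N.Normal ∧ N ≠ ⊥ ∧ IsPGroup q N := by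
  obtain ⟨A, hA, hA1, hc⟩ := exists_normal_abelian (G := G)
  have hcard : Nat.card A ≠ 1 := by
    intro h; exact hA1 (Subgroup.card_eq_one.1 h)
  obtain ⟨q, hq, hqd⟩ := Nat.exists_prime_and_dvd hcard
  have : Fact q.Prime := ⟨hq⟩
  obtain ⟨z, hz⟩ := exists_prime_orderOf_dvd_card' (G := A) q hqd
  let N : Subgroup G :=
    { carrier := {x | x ∈ A ∧ x ^ q = 1}
      one_mem' := ⟨A.one_mem, one_pow _⟩
      mul_mem' := by
        rintro x y ⟨hx, hx1⟩ ⟨hy, hy1⟩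
        refine ⟨A.mul_mem hx hy, ?_⟩
        rw [Commute.mul_pow (hc x hx y hy), hx1, hy1, one_mul]
      inv_mem' := by
        rintro x ⟨hx, hx1⟩
        exact ⟨A.inv_mem hx, by rw [inv_pow, hx1, inv_one]⟩ }
  refine ⟨q, N, hq, ⟨?_⟩, ?_, ?_⟩
  · rintro x ⟨hx, hx1⟩ g
    refine ⟨hA.conj_mem x hx g, ?_⟩
    rw [conj_pow, hx1, mul_one, mul_inv_cancel]
  · intro hN
    have : (z : G) ∈ N := ⟨z.2, by rw [← hz]; exact_mod_cast congrArg Subtype.val (pow_orderOf_eq_one z)⟩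
    rw [hN, Subgroup.mem_bot] at this
    have : z = 1 := Subtype.ext this
    rw [this, orderOf_one] at hz
    exact hq.ne_one hz.symm
  · rw [isPGroup_iff_pow_pow_eq_one]
    rintro ⟨x, hx, hx1⟩
    exact ⟨1, by ext; simpa using hx1⟩

theorem exists_p_complement (p : ℕ) (hp : p.Prime) (n : ℕ) : ∀ (G : Type u) [Group G] [Finite G] [Group.IsSolvable G],
    Nat.card G ≤ n → ∃ (K : Subgroup G) (k : ℕ), ¬ p ∣ Nat.card K ∧ Nat.card K * p ^ k = Nat.card G := by
  induction n with
  | zero => 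
    intro G _ _ _ h
    have := Nat.card_pos (α := G)
    omega
  | succ n ih =>
    intro G _ _ _ h
    rcases subsingleton_or_nontrivial G with hs | hs
    · refine ⟨⊤, 0, ?_, by simp⟩
      simp [hp.ne_one]
    · obtain ⟨q, N, hq, hN, hN1, hNq⟩ := exists_normal_pgroup (G := G)
      have hfq : Fact q.Prime := ⟨hq⟩
      obtain ⟨r, hr⟩ := IsPGroup.iff_card.1 hNq
      have hmul := Subgroup.card_eq_card_quotient_mul_card_subgroup N
      have hN2 : 2 ≤ Nat.card N := by
        have h1 := Nat.card_pos (α := N)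
        have h2 : Nat.card N ≠ 1 := fun h => hN1 (Subgroup.card_eq_one.1 h)
        omega
      have hQpos := Nat.card_pos (α := G ⧸ N)
      obtain ⟨K', k, hK1, hK2⟩ := ih (G ⧸ N) (by nlinarith)
      set K := K'.comap (QuotientGroup.mk' N) with hK
      have hNK : N ≤ K := by
        intro x hx
        have : QuotientGroup.mk' N x = 1 := by simpa using hx
        rw [hK, Subgroup.mem_comap, this]
        exact K'.one_mem
      have hidx : K.index = K'.index := Subgroup.index_comap_of_surjective _ (QuotientGroup.mk'_surjective N)
      have hc1 := Subgroup.card_mul_index K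
      have hc2 := Subgroup.card_mul_index K'
      have hK'pos := Nat.card_pos (α := K')
      have hidxp : K'.index = p ^ k := by
        apply Nat.eq_of_mul_eq_mul_left hK'pos
        rw [hc2, hK2]
      have hcK : Nat.card K = Nat.card K' * Nat.card N := by
        have : 0 < p ^ k := pow_pos hp.pos _
        apply Nat.eq_of_mul_eq_mul_right this
        rw [← hidxp, ← hidx, hc1, hmul, ← hc2, hidx]; ring
      by_cases hqp : q = p
      · subst hqp
        have hnor : (N.subgroupOf K).Normal := inferInstance
        have hcN : Nat.card (N.subgroupOf K) = Nat.card N :=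
          Nat.card_congr (Subgroup.subgroupOfEquivOfLe hNK).toEquiv
        have hiN : (N.subgroupOf K).index = Nat.card K' := by
          have := Subgroup.card_mul_index (N.subgroupOf K)
          rw [hcN, hcK, mul_comm] at this
          exact Nat.eq_of_mul_eq_mul_right (by omega) this
        obtain ⟨L, hL⟩ := Subgroup.exists_right_complement'_of_coprime (N := N.subgroupOf K) (by
          rw [hcN, hiN, hr]
          exact Nat.Coprime.pow_left _ ((Nat.Prime.coprime_iff_not_dvd hq).2 hK1))
        have hcL : Nat.card L = Nat.card K' := by
          have := hL.card_mul_card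
          rw [hcN, hcK, mul_comm] at this
          exact Nat.eq_of_mul_eq_mul_right (by omega) this
        have hcL2 : Nat.card (L.map K.subtype) = Nat.card L :=
          Nat.card_congr (L.equivMapOfInjective _ K.subtype_injective).toEquiv.symm
        refine ⟨L.map K.subtype, k + r, ?_, ?_⟩
        · rw [hcL2, hcL]; exact hK1
        · rw [hcL2, hcL, pow_add, ← hr, ← mul_assoc, hK2, hmul]
      · refine ⟨K, k, ?_, ?_⟩
        · rw [hcK, hr, hp.dvd_mul]
          rintro (h | h)
          · exact hK1 h
          · exact hqp ((Nat.prime_dvd_prime_iff_eq hp hq).1 (hp.dvd_of_dvd_pow h)).symm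
        · rw [hcK, mul_right_comm, hK2, hmul]

theorem GoodT2.split {G : Type u} [Group G] [Finite G] [Group.IsSolvable G] (hG : GoodT2 G) (p : ℕ) [hp : Fact p.Prime]
    (P : Sylow p G) : ∃ K : Subgroup G, P.Normal ∧ ¬ p ∣ Nat.card K ∧ Nonempty ((P × K) ≃* G) := by
  obtain ⟨K, k, hK, hKc⟩ := exists_p_complement p hp.out _ G le_rfl
  have hcop : Nat.Coprime (Nat.card P) (Nat.card K) := by
    rw [Sylow.card_eq_multiplicity]
    exact Nat.Coprime.pow_left _ ((Nat.Prime.coprime_iff_not_dvd hp.out).2 hK)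
  have hPc : Nat.card P = p ^ k := by
    rw [Sylow.card_eq_multiplicity, ← hKc]
    rw [Nat.factorization_mul Nat.card_pos.ne' (pow_pos hp.out.pos _).ne']
    rw [Finsupp.add_apply, Nat.factorization_eq_zero_of_not_dvd hK, hp.out.factorization_pow]
    simp
  have hcomp : Subgroup.IsComplement' (P : Subgroup G) K :=
    Subgroup.isComplement'_of_coprime (by rw [hPc, mul_comm]; exact hKc) hcop
  have hdis : Disjoint (P : Subgroup G) K := hcomp.disjoint
  have hdec : ∀ g : G, ∃ k ∈ (P : Subgroup G), ∃ h ∈ K, g = k * h := by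
    intro g
    obtain ⟨⟨a, b⟩, hab⟩ := hcomp.2 g
    exact ⟨a, a.2, b, b.2, hab.symm⟩
  have hcore : K.normalCore ⊓ (P : Subgroup G).normalCore = ⊥ := by
    rw [eq_bot_iff]
    intro x hx
    exact (Subgroup.disjoint_def.1 hdis) (Subgroup.normalCore_le _ hx.2) (Subgroup.normalCore_le _ hx.1)
  have hfac := hG.factor K P hdec hcore
  have hPn : (P : Subgroup G).Normal := by
    have : (P : Subgroup G).normalCore = P := by
      apply le_antisymm (Subgroup.normalCore_le _)
      intro x hx
      obtain ⟨a, ha, b, hb, rfl⟩ := hfac x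
      have hb' : b ∈ (P : Subgroup G) := by
        have := (P : Subgroup G).mul_mem ((P : Subgroup G).inv_mem (Subgroup.normalCore_le _ ha)) hx
        simpa using this
      have := (Subgroup.disjoint_def.1 hdis) hb' (Subgroup.normalCore_le _ hb)
      rw [this, mul_one]; exact ha
    rw [← this]; exact Subgroup.normalCore_normal _
  have hKn : K.Normal := by
    have : K.normalCore = K := by
      apply le_antisymm (Subgroup.normalCore_le _)
      intro x hx
      obtain ⟨a, ha, b, hb, rfl⟩ := hfac x
      have ha' : a ∈ K := by
        have := K.mul_mem hx (K.inv_mem (Subgroup.normalCore_le _ hb))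
        simpa using this
      have := (Subgroup.disjoint_def.1 hdis) (Subgroup.normalCore_le _ ha) ha'
      rw [this, one_mul]; exact hb
    rw [← this]; exact Subgroup.normalCore_normal _
  refine ⟨K, hPn, hK, ⟨MulEquiv.ofBijective (MonoidHom.noncommCoprod (P : Subgroup G).subtype K.subtype ?_) ?_⟩⟩
  · intro a b
    exact Subgroup.commute_of_normal_of_disjoint _ _ hPn hKn hdis a b a.2 b.2
  · exact hcomp

theorem line_disjoint {G : Type u} [Group G] [Finite G] (p : ℕ) (hp : p.Prime) (L L' : Subgroup G)
    (hL : Nat.card L = p) (hL' : Nat.card L' = p) (hne : L ≠ L') : L ⊓ L' = ⊥ := by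
  have h1 : Nat.card (L ⊓ L' : Subgroup G) ∣ p := hL ▸ Subgroup.card_dvd_of_le inf_le_left
  rcases (Nat.dvd_prime hp).1 h1 with h | h
  · exact Subgroup.card_eq_one.1 h
  · exfalso; apply hne
    have e1 : L ⊓ L' = L := Subgroup.eq_of_le_of_card_ge inf_le_left (by rw [h, hL])
    have e2 : L ⊓ L' = L' := Subgroup.eq_of_le_of_card_ge inf_le_right (by rw [h, hL'])
    rw [← e1, e2]

theorem line_mul {G : Type u} [Group G] [Finite G] (p : ℕ) (hp : p.Prime) (E L L' : Subgroup G)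
    (hE : Nat.card E = p * p) (hLE : L ≤ E) (hLE' : L' ≤ E)
    (hL : Nat.card L = p) (hL' : Nat.card L' = p) (hne : L ≠ L') (e : G) (he : e ∈ E) :
    ∃ l ∈ L, ∃ l' ∈ L', e = l * l' := by
  have hd := line_disjoint p hp L L' hL hL' hne
  have hc : Subgroup.IsComplement' (L.subgroupOf E) (L'.subgroupOf E) := by
    apply Subgroup.isComplement'_of_card_mul_and_disjoint
    · rw [Nat.card_congr (Subgroup.subgroupOfEquivOfLe hLE).toEquiv,
        Nat.card_congr (Subgroup.subgroupOfEquivOfLe hLE').toEquiv, hL, hL', hE]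
    · rw [Subgroup.disjoint_def]
      intro x hx hx'
      have : (x : G) ∈ L ⊓ L' := ⟨hx, hx'⟩
      rw [hd, Subgroup.mem_bot] at this
      exact Subtype.ext this
  obtain ⟨⟨l, l'⟩, h⟩ := hc.2 ⟨e, he⟩
  exact ⟨l.1, l.2, l'.1, l'.2, (congrArg Subtype.val h).symm⟩

theorem GoodT2.no_rank_two {G : Type u} [Group G] [Finite G] (hG : GoodT2 G) (p : ℕ) (hp : p.Prime)
    (E : Subgroup G) (hEn : E.Normal) (hE : Nat.card E = p * p) (hexp : ∀ x ∈ E, x ^ p = 1)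
    (hcom : ∀ x ∈ E, ∀ y ∈ E, x * y = y * x) : False := by
  have hzc : ∀ x ∈ E, x ≠ 1 → Nat.card (Subgroup.zpowers x) = p := by
    intro x hx hx1
    have := Fact.mk hp
    rw [Nat.card_zpowers]
    exact orderOf_eq_prime (hexp x hx) hx1
  have hp2 := hp.two_le
  -- z and w
  obtain ⟨z, hz, hz1⟩ : ∃ z ∈ E, z ≠ 1 := by
    by_contra hcon
    push Not at hcon
    have : E = ⊥ := by rw [Subgroup.eq_bot_iff_forall]; exact hcon
    rw [Subgroup.card_eq_one.2 this] at hE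
    nlinarith
  obtain ⟨w, hw, hwz⟩ : ∃ w ∈ E, w ∉ Subgroup.zpowers z := by
    by_contra hcon
    push Not at hcon
    have h1 : E ≤ Subgroup.zpowers z := hcon
    have h2 := Subgroup.card_le_of_le h1
    rw [hE, hzc z hz hz1] at h2
    nlinarith
  have hw1 : w ≠ 1 := by rintro rfl; exact hwz (Subgroup.one_mem _)
  set L1 := Subgroup.zpowers z with hL1
  set L2 := Subgroup.zpowers w with hL2
  set L3 := Subgroup.zpowers (z * w) with hL3
  have hzw : z * w ∈ E := E.mul_mem hz hw
  have hzw1 : z * w ∉ L1 := by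
    intro h
    apply hwz
    have := L1.mul_mem (L1.inv_mem (Subgroup.mem_zpowers z)) h
    simpa using this
  have hzw0 : z * w ≠ 1 := by intro h; rw [h] at hzw1; exact hzw1 L1.one_mem
  have n12 : L2 ≠ L1 := by intro h; exact hwz (h ▸ Subgroup.mem_zpowers w)
  have n13 : L3 ≠ L1 := by intro h; exact hzw1 (h ▸ Subgroup.mem_zpowers (z * w))
  have n23 : L2 ≠ L3 := by
    intro h
    have h1 : z * w ∈ L2 := h ▸ Subgroup.mem_zpowers (z * w)
    have h2 : z ∈ L2 := by
      have := L2.mul_mem h1 (L2.inv_mem (Subgroup.mem_zpowers w))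
      simpa using this
    have h3 := line_disjoint p hp L1 L2 (hzc z hz hz1) (hzc w hw hw1) n12.symm
    have h4 : z ∈ L1 ⊓ L2 := ⟨Subgroup.mem_zpowers z, h2⟩
    rw [h3, Subgroup.mem_bot] at h4
    exact hz1 h4
  let 𝓛 := {L : Subgroup G // L ≤ E ∧ Nat.card L = p}
  let Ω := Σ L : 𝓛, G ⧸ L.1
  have hmk : ∀ (L : 𝓛) (g x : G), g • (⟨L, (x : G ⧸ L.1)⟩ : Ω) = ⟨L, ((g * x : G) : G ⧸ L.1)⟩ := fun _ _ _ => rfl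
  have hst : ∀ (L : 𝓛) (g x : G), g ∈ MulAction.stabilizer G (⟨L, (x : G ⧸ L.1)⟩ : Ω) ↔ x⁻¹ * g * x ∈ L.1 := by
    intro L g x
    rw [MulAction.mem_stabilizer_iff, hmk, Sigma.mk.injEq]
    simp only [heq_eq_eq, true_and]
    rw [eq_comm, QuotientGroup.eq, mul_assoc]
  have hstm : ∀ (L : 𝓛) (x : G), MulAction.stabilizer G (⟨L, (x : G ⧸ L.1)⟩ : Ω) = L.1.map (MulAut.conj x).toMonoidHom := by
    intro L x
    ext g
    rw [hst]
    constructor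
    · intro h
      exact ⟨_, h, by simp; group⟩
    · rintro ⟨l, hl, rfl⟩
      have : x⁻¹ * ((MulAut.conj x).toMonoidHom l) * x = l := by simp; group
      rw [this]; exact hl
  have S1 : ∀ α : Ω, MulAction.stabilizer G α ≤ E ∧ Nat.card (MulAction.stabilizer G α) = p := by
    rintro ⟨L, x⟩
    induction x using QuotientGroup.induction_on with | H x => ?_
    constructor
    · intro g hg
      rw [hst] at hg
      have := hEn.conj_mem _ (L.2.1 hg) x
      have e : x * (x⁻¹ * g * x) * x⁻¹ = g := by group
      rwa [e] at this
    · rw [hstm]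
      refine Eq.trans ?_ L.2.2
      exact (Nat.card_congr (L.1.equivMapOfInjective _ (MulAut.conj x).injective).toEquiv).symm
  have S2 : ∀ L : Subgroup G, L ≤ E → Nat.card L = p → ∃ α : Ω, MulAction.stabilizer G α = L := by
    intro L h1 h2
    refine ⟨⟨⟨L, h1, h2⟩, ((1 : G) : G ⧸ L)⟩, ?_⟩
    ext g
    rw [hst]; simp
  obtain ⟨α1, hα1⟩ := S2 L1 (Subgroup.zpowers_le.2 hz) (hzc z hz hz1)
  obtain ⟨α2, hα2⟩ := S2 L2 (Subgroup.zpowers_le.2 hw) (hzc w hw hw1)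
  obtain ⟨α3, hα3⟩ := S2 L3 (Subgroup.zpowers_le.2 hzw) (hzc _ hzw hzw0)
  have hdis : ∀ g : G, g • α2 = α2 → g • α3 = α3 → g = 1 := by
    intro g h2 h3
    have h4 : g ∈ L2 ⊓ L3 := ⟨hα2 ▸ h2, hα3 ▸ h3⟩
    rw [line_disjoint p hp L2 L3 (hzc w hw hw1) (hzc _ hzw hzw0) n23] at h4
    simpa using h4
  have hfaith : FaithfulSMul G Ω := ⟨fun {x y} hxy => by
    have := hdis (y⁻¹ * x) (by rw [mul_smul, hxy, inv_smul_smul]) (by rw [mul_smul, hxy, inv_smul_smul])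
    rw [inv_mul_eq_one] at this
    exact this.symm⟩
  have hfin : Finite Ω := by
    have : Finite 𝓛 := Subtype.finite
    exact inferInstance
  have hse : ∀ α : Ω, MulAction.stabilizer G (w • α) = MulAction.stabilizer G α := by
    intro α
    ext g
    constructor
    · intro hg
      have hgE := (S1 _).1 hg
      rw [MulAction.mem_stabilizer_iff, ← mul_smul, hcom g hgE w hw, mul_smul] at hg
      exact smul_left_cancel w hg
    · intro hg
      have hgE := (S1 _).1 hg
      rw [MulAction.mem_stabilizer_iff, ← mul_smul, hcom g hgE w hw, mul_smul, MulAction.mem_stabilizer_iff.1 hg]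
  obtain ⟨g, h1, h2⟩ := hG.switch Ω {α | MulAction.stabilizer G α = L1} w
    (by intro α; simp only [Set.mem_ofPred_eq, hse])
    (by
      intro α hα β hβ
      simp only [Set.mem_ofPred_eq] at hα hβ
      obtain ⟨l, hl, l', hl', e⟩ := line_mul p hp E _ _ hE (S1 β).1 (S1 α).1 (S1 β).2 (S1 α).2
        (by rw [hα]; exact hβ) w hw
      refine ⟨l, ?_, hl⟩
      rw [e, mul_smul, MulAction.mem_stabilizer_iff.1 hl'])
  have hg1 := hdis g (h2 α2 (by simpa [hα2] using n12)) (h2 α3 (by simpa [hα3] using n13))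
  have := h1 α1 hα1
  rw [hg1, one_smul] at this
  apply hwz
  rw [← hα1]
  exact this.symm

theorem GoodT2.no_pair {G : Type u} [Group G] [Finite G] (hG : GoodT2 G) (p : ℕ) (hp : p.Prime)
    (z w : G) (hz : orderOf z = p) (hzc : ∀ g, g * z = z * g) (hw : w ^ p = 1)
    (hwz : w ∉ Subgroup.zpowers z) (hg : ∀ g, g * w * g⁻¹ * w⁻¹ ∈ Subgroup.zpowers z) : False := by
  have := Fact.mk hp
  have hw1 : w ≠ 1 := by rintro rfl; exact hwz (Subgroup.one_mem _)
  have hwo : orderOf w = p := orderOf_eq_prime hw hw1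
  have hzcen : ∀ y ∈ Subgroup.zpowers z, ∀ g, g * y = y * g := by
    rintro _ ⟨k, rfl⟩ g
    exact (Commute.zpow_right (show Commute g z from hzc g) k)
  have hZn : (Subgroup.zpowers z).Normal := ⟨fun y hy g => by rw [hzcen y hy g]; simpa using hy⟩
  set E := Subgroup.zpowers z ⊔ Subgroup.zpowers w with hEdef
  have hmem : ∀ x ∈ E, ∃ y ∈ Subgroup.zpowers z, ∃ k : ℤ, x = y * w ^ k := by
    intro x hx
    rw [hEdef, Subgroup.mem_sup_of_normal_left] at hx
    obtain ⟨y, hy, _, ⟨k, rfl⟩, rfl⟩ := hx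
    exact ⟨y, hy, k, rfl⟩
  have hzE : Subgroup.zpowers z ≤ E := le_sup_left
  have hwE : w ∈ E := (le_sup_right : _ ≤ E) (Subgroup.mem_zpowers w)
  have hyp : ∀ y ∈ Subgroup.zpowers z, y ^ p = 1 := by
    rintro _ ⟨k, rfl⟩
    simp only
    rw [← zpow_natCast, ← zpow_mul, mul_comm, zpow_mul, zpow_natCast, ← hz, pow_orderOf_eq_one, one_zpow]
  refine hG.no_rank_two p hp E ⟨?_⟩ ?_ ?_ ?_
  · intro x hx g
    obtain ⟨y, hy, k, rfl⟩ := hmem x hx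
    have e : g * (y * w ^ k) * g⁻¹ = (g * y * g⁻¹) * (g * w * g⁻¹) ^ k := by
      rw [conj_zpow]; group
    rw [e]
    refine E.mul_mem (hzE (hZn.conj_mem y hy g)) (E.zpow_mem ?_ _)
    have := E.mul_mem (hzE (hg g)) hwE
    simpa using this
  · have hc : Subgroup.IsComplement' ((Subgroup.zpowers z).subgroupOf E) ((Subgroup.zpowers w).subgroupOf E) := by
      apply Subgroup.isComplement'_of_disjoint_and_mul_eq_univ
      · rw [Subgroup.disjoint_def]
        intro x hx hx'
        have h3 := line_disjoint p hp (Subgroup.zpowers z) (Subgroup.zpowers w) (by rw [Nat.card_zpowers, hz])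
          (by rw [Nat.card_zpowers, hwo]) (by intro h; exact hwz (h ▸ Subgroup.mem_zpowers w))
        have : (x : G) ∈ Subgroup.zpowers z ⊓ Subgroup.zpowers w := ⟨hx, hx'⟩
        rw [h3, Subgroup.mem_bot] at this
        exact Subtype.ext this
      · rw [Set.eq_univ_iff_forall]
        rintro ⟨x, hx⟩
        obtain ⟨y, hy, k, rfl⟩ := hmem x hx
        exact ⟨⟨y, hzE hy⟩, hy, ⟨w ^ k, E.zpow_mem hwE k⟩, ⟨k, rfl⟩, rfl⟩
    have := hc.card_mul_card
    rw [Nat.card_congr (Subgroup.subgroupOfEquivOfLe hzE).toEquiv,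
      Nat.card_congr (Subgroup.subgroupOfEquivOfLe (le_sup_right : _ ≤ E)).toEquiv, Nat.card_zpowers, Nat.card_zpowers, hz, hwo] at this
    exact this.symm
  · intro x hx
    obtain ⟨y, hy, k, rfl⟩ := hmem x hx
    have hc : Commute y (w ^ k) := (hzcen y hy _).symm
    rw [hc.mul_pow, hyp y hy, one_mul, ← zpow_natCast, ← zpow_mul, mul_comm, zpow_mul, zpow_natCast, hw, one_zpow]
  · intro x hx x' hx'
    obtain ⟨y, hy, k, rfl⟩ := hmem x hx
    obtain ⟨y', hy', k', rfl⟩ := hmem x' hx'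
    have c1 : ∀ g, Commute y g := fun g => (hzcen y hy g).symm
    have c2 : ∀ g, Commute y' g := fun g => (hzcen y' hy' g).symm
    have : Commute (y * w ^ k) (y' * w ^ k') := by
      apply Commute.mul_left (c1 _)
      apply Commute.mul_right (c2 _).symm
      exact (Commute.refl w).zpow_zpow k k'
    exact this

theorem exists_central_step {G : Type u} [Group G] [Group.IsNilpotent G] (N M : Subgroup G) (hM : M.Normal)
    (h : ¬ M ≤ N) : ∃ w ∈ M, w ∉ N ∧ ∀ g, g * w * g⁻¹ * w⁻¹ ∈ N := by
  classical
  have hex : ∃ n, ¬ (M ⊓ Subgroup.upperCentralSeries G n ≤ N) := by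
    obtain ⟨n, hn⟩ := Group.IsNilpotent.nilpotent (G := G)
    exact ⟨n, by rw [hn, inf_top_eq]; exact h⟩
  have h0 : Nat.find hex ≠ 0 := by
    intro h
    apply Nat.find_spec hex
    rw [h, Subgroup.upperCentralSeries_zero, inf_bot_eq]
    exact bot_le
  obtain ⟨n, hn⟩ := Nat.exists_eq_succ_of_ne_zero h0
  have h1 := Nat.find_spec hex
  have h2 := Nat.find_min hex (m := n) (by omega)
  rw [hn] at h1
  push Not at h2
  rw [SetLike.not_le_iff_exists] at h1
  obtain ⟨w, ⟨hwM, hwZ⟩, hwN⟩ := h1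
  refine ⟨w, hwM, hwN, fun g => ?_⟩
  have hwZ2 : w ∈ Subgroup.upperCentralSeries G (n+1) := hwZ
  rw [Subgroup.mem_upperCentralSeries_succ_iff] at hwZ2
  have h3 := hwZ2 g
  have h4 : w * g * w⁻¹ * g⁻¹ ∈ M := by
    have := M.mul_mem hwM (hM.conj_mem _ (M.inv_mem hwM) g)
    simpa [mul_assoc] using this
  have h5 := N.inv_mem (h2 ⟨h4, h3⟩)
  simpa [mul_assoc] using h5

theorem exists_pow_step {G : Type u} [Group G] (p : ℕ) (hG : IsPGroup p G) (S : Subgroup G) (b : G)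
    (hb : b ∉ S) : ∃ k, b ^ p ^ k ∉ S ∧ (b ^ p ^ k) ^ p ∈ S := by
  classical
  have hex : ∃ k, b ^ p ^ k ∈ S := by
    obtain ⟨k, hk⟩ := (isPGroup_iff_pow_pow_eq_one.1 hG) b
    exact ⟨k, by rw [hk]; exact S.one_mem⟩
  have h0 : Nat.find hex ≠ 0 := by
    intro h
    have := Nat.find_spec hex
    rw [h] at this
    simp at this
    exact hb this
  obtain ⟨n, hn⟩ := Nat.exists_eq_succ_of_ne_zero h0
  refine ⟨n, Nat.find_min hex (by omega), ?_⟩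
  have := Nat.find_spec hex
  rw [hn] at this
  rw [← pow_mul, ← pow_succ]
  exact this

theorem cyclic_of_unique {A : Type u} [CommGroup A] [Finite A] (p : ℕ) (hp : p.Prime) (hA : IsPGroup p A)
    (z : A) (hu : ∀ x : A, x ^ p = 1 → x ∈ Subgroup.zpowers z) (hz : orderOf z = p) : IsCyclic A := by
  have hf := Fact.mk hp
  obtain ⟨a, ha⟩ := Monoid.exists_orderOf_eq_exponent (G := A) (Monoid.ExponentExists.of_finite)
  obtain ⟨n, hn⟩ := IsPGroup.iff_orderOf.1 hA a
  have hexp : ∀ x : A, x ^ p ^ n = 1 := by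
    intro x
    rw [← hn, ha]; exact Monoid.pow_exponent_eq_one x
  have hn0 : n ≠ 0 := by
    rintro rfl
    have := hexp z
    simp at this
    rw [this, orderOf_one] at hz
    exact hp.ne_one hz.symm
  have hza : z ∈ Subgroup.zpowers a := by
    -- a ^ (p^(n-1)) has order p, so lies in <z>, thus generates
    have ho : orderOf (a ^ (orderOf a / p)) = p :=
      orderOf_pow_orderOf_div (by rw [hn]; exact (pow_pos hp.pos _).ne') (by rw [hn]; exact dvd_pow_self _ hn0)
    set y := a ^ (orderOf a / p) with hy
    have hyz : y ∈ Subgroup.zpowers z := hu y (by rw [← ho, pow_orderOf_eq_one])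
    have h1 : Subgroup.zpowers y = Subgroup.zpowers z := 
      Subgroup.eq_of_le_of_card_ge (Subgroup.zpowers_le.2 hyz) (by rw [Nat.card_zpowers, Nat.card_zpowers, ho, hz])
    have h2 : z ∈ Subgroup.zpowers y := h1 ▸ Subgroup.mem_zpowers z
    exact (Subgroup.zpowers_le.2 (Subgroup.pow_mem _ (Subgroup.mem_zpowers a) _)) h2
  refine ⟨a, fun b => ?_⟩
  by_contra hb
  obtain ⟨k, hk1, hk2⟩ := exists_pow_step p hA (Subgroup.zpowers a) b hb
  set c := b ^ p ^ k with hc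
  obtain ⟨j, hj⟩ := hk2
  simp only at hj
  by_cases hpj : (p : ℤ) ∣ j
  · obtain ⟨i, rfl⟩ := hpj
    have h1 : (c * (a ^ i)⁻¹) ^ p = 1 := by
      rw [mul_pow, ← hj, inv_pow, ← zpow_natCast (a ^ i), ← zpow_mul, mul_comm i, mul_inv_cancel]
    have h2 := (Subgroup.zpowers_le.2 hza) (hu _ h1)
    have h3 := (Subgroup.zpowers a).mul_mem h2 (Subgroup.zpow_mem _ (Subgroup.mem_zpowers a) i)
    apply hk1
    simpa using h3
  · obtain ⟨n', rfl⟩ := Nat.exists_eq_succ_of_ne_zero hn0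
    have h1 : c ^ p ^ (n' + 1) = 1 := hexp c
    rw [pow_succ', pow_mul, ← hj, ← zpow_natCast, ← zpow_mul] at h1
    have h2 := orderOf_dvd_iff_zpow_eq_one.2 h1
    rw [hn] at h2
    apply hpj
    push_cast at h2
    rw [Nat.succ_eq_add_one, pow_succ', mul_comm j] at h2
    have : (p : ℤ) ^ n' ≠ 0 := pow_ne_zero _ (by exact_mod_cast hp.ne_zero)
    rw [mul_comm (p : ℤ)] at h2
    exact (mul_dvd_mul_iff_left this).1 h2

theorem GoodT2.exists_struct {G : Type u} [Group G] [Finite G] [Nontrivial G] (hG : GoodT2 G) (p : ℕ) (hp : p.Prime)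
    (hP : IsPGroup p G) : ∃ a z : G, orderOf z = p ∧ (∀ g, g * z = z * g) ∧ z ∈ Subgroup.zpowers a ∧
      (Subgroup.zpowers a).Normal ∧ (∀ x, x * a = a * x → x ∈ Subgroup.zpowers a) := by
  have hf := Fact.mk hp
  have hnil : Group.IsNilpotent G := hP.isNilpotent
  obtain ⟨z, hz, hzc⟩ : ∃ z : G, orderOf z = p ∧ (∀ g, g * z = z * g) := by
    have := hP.center_nontrivial
    have hd : p ∣ Nat.card (Subgroup.center G) := by
      rcases (hP.to_subgroup (Subgroup.center G)).card_eq_or_dvd with h | h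
      · exact absurd h (Finite.one_lt_card).ne'
      · exact h
    obtain ⟨z, hz⟩ := exists_prime_orderOf_dvd_card' p hd
    refine ⟨z, ?_, fun g => Subgroup.mem_center_iff.1 z.2 g⟩
    rw [Subgroup.orderOf_coe]; exact hz
  obtain ⟨A, hAmax⟩ := Set.Finite.exists_maximal (s := {A : Subgroup G | A.Normal ∧ ∀ x ∈ A, ∀ y ∈ A, x * y = y * x})
    (Set.toFinite _) ⟨⊥, inferInstance, by
      intro x hx y hy
      rw [Subgroup.mem_bot] at hx hy
      rw [hx, hy]⟩
  obtain ⟨⟨hAn, hAc⟩, hmax⟩ := hAmax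
  have hcent : ∀ x, (∀ y ∈ A, x * y = y * x) → x ∈ A := by
    intro x hx
    by_contra hxA
    have hCn : (Subgroup.centralizer (A : Set G)).Normal := inferInstance
    obtain ⟨w, hwC, hwA, hw⟩ := exists_central_step A (Subgroup.centralizer (A : Set G)) hCn (by
      intro hle
      exact hxA (hle (Subgroup.mem_centralizer_iff.2 (fun y hy => (hx y hy).symm))))
    have hwc : ∀ y ∈ A, Commute y w := fun y hy => Subgroup.mem_centralizer_iff.1 hwC y hy
    have hAB : A ≤ A ⊔ Subgroup.zpowers w := le_sup_left
    have hwB : w ∈ A ⊔ Subgroup.zpowers w := (le_sup_right : Subgroup.zpowers w ≤ _) (Subgroup.mem_zpowers w)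
    have hmem : ∀ x ∈ A ⊔ Subgroup.zpowers w, ∃ y ∈ A, ∃ k : ℤ, x = y * w ^ k := by
      intro x hx
      rw [Subgroup.mem_sup_of_normal_left] at hx
      obtain ⟨y, hy, _, ⟨k, rfl⟩, rfl⟩ := hx
      exact ⟨y, hy, k, rfl⟩
    apply hwA
    refine hmax (y := A ⊔ Subgroup.zpowers w) ⟨⟨?_⟩, ?_⟩ hAB hwB
    · intro x hx g
      obtain ⟨y, hy, k, rfl⟩ := hmem x hx
      have e : g * (y * w ^ k) * g⁻¹ = (g * y * g⁻¹) * (g * w * g⁻¹) ^ k := by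
        rw [conj_zpow]; group
      rw [e]
      refine Subgroup.mul_mem _ (hAB (hAn.conj_mem y hy g)) (Subgroup.zpow_mem _ ?_ _)
      have := Subgroup.mul_mem _ (hAB (hw g)) hwB
      simpa using this
    · intro x hx x' hx'
      obtain ⟨y, hy, k, rfl⟩ := hmem x hx
      obtain ⟨y', hy', k', rfl⟩ := hmem x' hx'
      have : Commute (y * w ^ k) (y' * w ^ k') := by
        apply Commute.mul_left
        · exact Commute.mul_right (hAc y hy y' hy') ((hwc y hy).zpow_right _)
        · exact Commute.mul_right ((hwc y' hy').zpow_right _).symm ((Commute.refl w).zpow_zpow k k')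
      exact this
  have hzA : z ∈ A := hcent z (fun y _ => (hzc y).symm)
  let O : Subgroup G :=
    { carrier := {x | x ∈ A ∧ x ^ p = 1}
      one_mem' := ⟨A.one_mem, one_pow _⟩
      mul_mem' := by
        rintro x y ⟨hx, hx1⟩ ⟨hy, hy1⟩
        refine ⟨A.mul_mem hx hy, ?_⟩
        rw [Commute.mul_pow (hAc x hx y hy), hx1, hy1, one_mul]
      inv_mem' := by
        rintro x ⟨hx, hx1⟩
        exact ⟨A.inv_mem hx, by rw [inv_pow, hx1, inv_one]⟩ }
  have hOn : O.Normal := ⟨by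
    rintro x ⟨hx, hx1⟩ g
    refine ⟨hAn.conj_mem x hx g, ?_⟩
    rw [conj_pow, hx1, mul_one, mul_inv_cancel]⟩
  have hO : O ≤ Subgroup.zpowers z := by
    by_contra hcon
    obtain ⟨w, hwO, hwz, hw⟩ := exists_central_step _ O hOn hcon
    exact hG.no_pair p hp z w hz hzc hwO.2 hwz hw
  have hcyc : IsCyclic A := by
    let _ : CommGroup A := { (inferInstance : Group A) with mul_comm := fun x y => Subtype.ext (hAc x x.2 y y.2) }
    refine cyclic_of_unique (A := A) p hp (hP.to_subgroup A) ⟨z, hzA⟩ ?_ ?_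
    · intro x hx
      obtain ⟨k, hk⟩ := hO (show (x : G) ∈ O from ⟨x.2, by exact_mod_cast congrArg Subtype.val hx⟩)
      exact ⟨k, Subtype.ext (by simpa using hk)⟩
    · rw [← Subgroup.orderOf_coe]; exact hz
  obtain ⟨⟨a, haA⟩, ha⟩ := hcyc
  have hA : A = Subgroup.zpowers a := by
    apply le_antisymm
    · intro x hx
      obtain ⟨k, hk⟩ := ha ⟨x, hx⟩
      exact ⟨k, by simpa using congrArg Subtype.val hk⟩
    · exact Subgroup.zpowers_le.2 haA
  refine ⟨a, z, hz, hzc, hA ▸ hzA, hA ▸ hAn, fun x hx => ?_⟩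
  rw [← hA]
  apply hcent
  intro y hy
  rw [hA] at hy
  obtain ⟨k, rfl⟩ := hy
  exact Commute.zpow_right hx k

theorem conj_mul_zpow {G : Type u} [Group G] {a x : G} {k : ℤ} (h : x * a * x⁻¹ = a ^ k) (i : ℤ) :
    x * a ^ i = a ^ (k * i) * x := by
  rw [zpow_mul, ← h, conj_zpow]; group

theorem conj_mul_conj {G : Type u} [Group G] {a x y : G} {k l : ℤ} (h : x * a * x⁻¹ = a ^ k)
    (h2 : y * a * y⁻¹ = a ^ l) : (x * y) * a * (x * y)⁻¹ = a ^ (k * l) := by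
  have : (x * y) * a * (x * y)⁻¹ = x * (y * a * y⁻¹) * x⁻¹ := by group
  rw [this, h2, conj_mul_zpow h]; group

theorem conj_pow_pow {G : Type u} [Group G] {a x : G} {k : ℤ} (h : x * a * x⁻¹ = a ^ k) (m : ℕ) :
    (x ^ m) * a * (x ^ m)⁻¹ = a ^ (k ^ m) := by
  induction m with
  | zero => simp
  | succ m ih => rw [pow_succ, pow_succ]; exact conj_mul_conj ih h

theorem shift_pow {G : Type u} [Group G] {a x : G} {k : ℤ} (h : x * a * x⁻¹ = a ^ k) (i : ℤ) (m : ℕ) :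
    (a ^ i * x) ^ m = a ^ (i * ∑ j ∈ Finset.range m, k ^ j) * x ^ m := by
  induction m with
  | zero => simp
  | succ m ih =>
    rw [pow_succ', ih, geom_sum_succ, pow_succ']
    have h1 := conj_mul_zpow h (i * ∑ j ∈ Finset.range m, k ^ j)
    calc a ^ i * x * (a ^ (i * ∑ j ∈ Finset.range m, k ^ j) * x ^ m)
        = a ^ i * (x * a ^ (i * ∑ j ∈ Finset.range m, k ^ j)) * x ^ m := by group
      _ = a ^ i * a ^ (k * (i * ∑ j ∈ Finset.range m, k ^ j)) * (x * x ^ m) := by rw [h1]; group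
      _ = _ := by rw [← zpow_add]; congr 2; ring

theorem geom_good (p : ℕ) (hp : p.Prime) (k : ℤ) (h : (p:ℤ) ∣ k - 1) (h2 : p = 2 → (4:ℤ) ∣ k - 1) :
    ∃ u : ℤ, ∑ j ∈ Finset.range p, k ^ j = p * u ∧ IsCoprime u (p:ℤ) := by
  have key : ∃ t : ℤ, ∑ j ∈ Finset.range p, k ^ j = p + p ^ 2 * t := by
    rcases hp.eq_two_or_odd' with rfl | ho
    · obtain ⟨c, hc⟩ := h2 rfl
      refine ⟨c, ?_⟩
      simp [Finset.sum_range_succ]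
      linarith
    · obtain ⟨c, hc⟩ := h
      have := odd_sq_dvd_geom_sum₂_sub (R := ℤ) (a := 1) (b := c) (p := p) ho
      obtain ⟨t, ht⟩ := this
      refine ⟨t, ?_⟩
      have hk : k = 1 + p * c := by linarith
      rw [hk]
      simp at ht
      linarith
  obtain ⟨t, ht⟩ := key
  refine ⟨1 + p * t, by rw [ht]; ring, ⟨1, -t, by ring⟩⟩

theorem conj_mod_p {G : Type u} [Group G] (p : ℕ) (hp : p.Prime) (hP : IsPGroup p G) {a x : G} {k : ℤ}
    (h : x * a * x⁻¹ = a ^ k) (ha : p ∣ orderOf a) : (p:ℤ) ∣ k - 1 := by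
  have hf := Fact.mk hp
  obtain ⟨r, hr⟩ := (isPGroup_iff_pow_pow_eq_one.1 hP) x
  have h1 := conj_pow_pow h (p ^ r)
  rw [hr] at h1
  have h2 : a ^ (k ^ p ^ r - 1) = 1 := by rw [zpow_sub, ← h1]; simp
  have h3 := orderOf_dvd_iff_zpow_eq_one.2 h2
  have h4 : (p:ℤ) ∣ k ^ p ^ r - 1 := dvd_trans (by exact_mod_cast ha) h3
  rw [← ZMod.intCast_zmod_eq_zero_iff_dvd] at h4 ⊢
  push_cast at h4 ⊢
  rwa [ZMod.pow_card_pow] at h4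

theorem comm_commutes {G : Type u} [Group G] {a : G} (hN : (Subgroup.zpowers a).Normal) (g w : G) :
    (g * w * g⁻¹ * w⁻¹) * a = a * (g * w * g⁻¹ * w⁻¹) := by
  have hc : ∀ x : G, ∃ k : ℤ, x * a * x⁻¹ = a ^ k := fun x => by
    obtain ⟨k, hk⟩ := hN.conj_mem a (Subgroup.mem_zpowers a) x
    exact ⟨k, hk.symm⟩
  obtain ⟨k, hk⟩ := hc g
  obtain ⟨l, hl⟩ := hc w
  have h1 := conj_mul_conj hk hl
  have h2 := conj_mul_conj hl hk
  obtain ⟨s, hs⟩ := hc (w * g)⁻¹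
  have h3 := conj_mul_zpow h1 s
  have h4 := conj_mul_zpow h2 s
  have h5 : (w * g) * a ^ s = a * (w * g) := by rw [← hs]; group
  rw [mul_comm l k] at h4
  have h6 : a ^ (k * l * s) = a := by
    rw [h5] at h4
    exact (mul_right_cancel h4).symm
  rw [h6] at h3
  have h7 : (g * w * g⁻¹ * w⁻¹) * a = (g * w) * ((w * g)⁻¹ * a * (w * g)⁻¹⁻¹) * (w * g)⁻¹ := by group
  rw [h7, hs, h3]; group

theorem GoodT2.step_one {G : Type u} [Group G] [Finite G] (hG : GoodT2 G) (p : ℕ) (hp : p.Prime)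
    (hP : IsPGroup p G) (a z : G) (hz : orderOf z = p) (hzc : ∀ g, g * z = z * g)
    (hza : z ∈ Subgroup.zpowers a) (hN : (Subgroup.zpowers a).Normal)
    (hC : ∀ x, x * a = a * x → x ∈ Subgroup.zpowers a) (w : G) (hw : w ^ p = 1) :
    w ∈ Subgroup.zpowers a := by
  have hf := Fact.mk hp
  by_contra hwa
  have hpa : p ∣ orderOf a := by
    rw [← hz]; exact orderOf_dvd_of_mem_zpowers hza
  obtain ⟨n, hn⟩ := IsPGroup.iff_orderOf.1 hP a
  have hc : ∀ x : G, ∃ k : ℤ, x * a * x⁻¹ = a ^ k := fun x => by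
    obtain ⟨k, hk⟩ := hN.conj_mem a (Subgroup.mem_zpowers a) x
    exact ⟨k, hk.symm⟩
  have hu : ∀ y ∈ Subgroup.zpowers a, y ^ p = 1 → y ∈ Subgroup.zpowers z := by
    intro y hy hyp
    have := unique_of_cyclic (X := Subgroup.zpowers a) p hp.pos ⟨z, hza⟩ ⟨y, hy⟩
      (by rw [← hz]; exact Subgroup.orderOf_mk _ _) (Subtype.ext hyp)
    obtain ⟨i, hi⟩ := this
    exact ⟨i, congrArg Subtype.val hi⟩
  obtain ⟨k, hk⟩ := hc w
  have hk1 := conj_mod_p p hp hP hk hpa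
  by_cases hgood : p = 2 → (4:ℤ) ∣ k - 1
  · obtain ⟨s, hs, hcop⟩ := geom_good p hp k hk1 hgood
    apply hG.no_pair p hp z w hz hzc hw
    · intro h
      exact hwa ((Subgroup.zpowers_le.2 hza) h)
    · intro g
      have h1 := hC _ (comm_commutes hN g w)
      apply hu _ h1
      obtain ⟨i, hi⟩ := h1
      have hi : a ^ i = g * w * g⁻¹ * w⁻¹ := hi
      have h2 : (a ^ i * w) ^ p = 1 := by
        rw [hi]
        have : g * w * g⁻¹ * w⁻¹ * w = g * w * g⁻¹ := by group
        rw [this, conj_pow, hw]; simp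
      rw [shift_pow hk, hw, mul_one, hs] at h2
      have h3 := orderOf_dvd_iff_zpow_eq_one.2 h2
      rw [← hi, ← zpow_natCast, ← zpow_mul]
      apply orderOf_dvd_iff_zpow_eq_one.1
      have h4 : IsCoprime ((orderOf a : ℕ) : ℤ) s := by
        rw [hn]; push_cast
        exact hcop.symm.pow_left
      rw [← mul_assoc] at h3
      exact h4.dvd_of_dvd_mul_right h3
  · push Not at hgood
    obtain ⟨rfl, h4⟩ := hgood
    have hn2 : (4:ℤ) ∣ (orderOf a : ℕ) := by
      have : 2 ≤ n := by
        by_contra hlt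
        have hn1 : n = 1 ∨ n = 0 := by omega
        apply hwa
        apply hC
        have : a ^ k = a := by
          have : a ^ (k - 1) = 1 := by
            apply orderOf_dvd_iff_zpow_eq_one.1
            rw [hn]
            rcases hn1 with rfl | rfl
            · simpa using hk1
            · simp
          rw [zpow_sub, zpow_one, mul_inv_eq_one] at this
          exact this
        rw [this] at hk
        exact mul_inv_eq_iff_eq_mul.1 hk
      rw [hn]
      have : 2 ^ 2 ∣ 2 ^ n := pow_dvd_pow 2 this
      exact_mod_cast this
    have hdv : ∀ i j : ℤ, a ^ i = a ^ j → (4:ℤ) ∣ i - j := by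
      intro i j h
      apply dvd_trans hn2
      apply orderOf_dvd_iff_zpow_eq_one.2
      rw [zpow_sub, h, mul_inv_cancel]
    let M : Subgroup G :=
      { carrier := {g | ∃ l : ℤ, g * a * g⁻¹ = a ^ l ∧ (4:ℤ) ∣ l - 1}
        one_mem' := ⟨1, by simp, by simp⟩
        mul_mem' := by
          rintro g h ⟨l, hl, hl4⟩ ⟨m, hm, hm4⟩
          refine ⟨l * m, conj_mul_conj hl hm, ?_⟩
          have : l * m - 1 = (l - 1) * m + (m - 1) := by ring
          rw [this]
          exact dvd_add (Dvd.dvd.mul_right hl4 _) hm4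
        inv_mem' := by
          rintro g ⟨l, hl, hl4⟩
          obtain ⟨m, hm⟩ := hc g⁻¹
          refine ⟨m, hm, ?_⟩
          have h1 := conj_mul_conj hl hm
          have h2 : a ^ (l * m) = a ^ (1:ℤ) := by rw [← h1]; simp
          have h3 := hdv _ _ h2
          have : m - 1 = (l * m - 1) - (l - 1) * m := by ring
          rw [this]
          exact dvd_sub h3 (Dvd.dvd.mul_right hl4 _) }
    have hzw : ∀ y ∈ Subgroup.zpowers w, y = 1 ∨ y = w := by
      rintro y ⟨i, rfl⟩
      rcases Int.even_or_odd' i with ⟨j, rfl | rfl⟩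
      · left
        have : w ^ (2:ℤ) = 1 := by exact_mod_cast hw
        simp [zpow_mul, this]
      · right
        have : w ^ (2:ℤ) = 1 := by exact_mod_cast hw
        simp [zpow_mul, zpow_add, this]
    have hw1 : w ≠ 1 := fun h => hwa (h ▸ Subgroup.one_mem _)
    have hcore : (Subgroup.zpowers w).normalCore = ⊥ := by
      rw [eq_bot_iff]
      intro y hy
      rcases hzw y (Subgroup.normalCore_le _ hy) with h | h
      · simpa using h
      · exfalso
        apply hwa
        apply hC
        rw [h] at hy
        have h1 := hzw _ (hy a⁻¹)
        rcases h1 with h1 | h1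
        · rw [conj_eq_one_iff] at h1
          exact absurd h1 hw1
        · rw [inv_inv] at h1
          rw [mul_assoc, inv_mul_eq_iff_eq_mul] at h1
          exact h1
    have hwi : w⁻¹ = w := by
      rw [inv_eq_iff_mul_eq_one, ← sq, hw]
    have hfac := hG.factor (Subgroup.zpowers w) M (fun g => by
      obtain ⟨l, hl⟩ := hc g
      have hl1 := conj_mod_p 2 hp hP hl hpa
      by_cases hl4 : (4:ℤ) ∣ l - 1
      · exact ⟨g, ⟨l, hl, hl4⟩, 1, Subgroup.one_mem _, by simp⟩
      · refine ⟨g * w, ⟨l * k, conj_mul_conj hl hk, ?_⟩, w, Subgroup.mem_zpowers w, ?_⟩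
        · obtain ⟨c, hc⟩ : ∃ c, l = 4 * c + 3 := ⟨(l - 3) / 4, by push_cast at hl1; omega⟩
          obtain ⟨d, hd⟩ : ∃ c, k = 4 * c + 3 := ⟨(k - 3) / 4, by push_cast at hk1; omega⟩
          rw [hc, hd]
          exact ⟨4 * c * d + 3 * c + 3 * d + 2, by ring⟩
        · rw [mul_assoc, ← sq, hw, mul_one]) (by rw [hcore, bot_inf_eq]) w
    obtain ⟨m, hm, h, hh, he⟩ := hfac
    rw [hcore, Subgroup.mem_bot] at hh
    rw [hh, mul_one] at he
    rw [← he] at hm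
    obtain ⟨l, hl, hl4⟩ := Subgroup.normalCore_le _ hm
    have := hdv _ _ (hk.symm.trans hl)
    omega

theorem GoodT2.step_two {G : Type u} [Group G] [Finite G] (hG : GoodT2 G) (p : ℕ) (hp : p.Prime)
    (hP : IsPGroup p G) (a z : G) (hz : orderOf z = p) (hzc : ∀ g, g * z = z * g)
    (hza : z ∈ Subgroup.zpowers a) (hN : (Subgroup.zpowers a).Normal)
    (hC : ∀ x, x * a = a * x → x ∈ Subgroup.zpowers a) (x : G) (hx : x ∉ Subgroup.zpowers a)
    (hxp : x ^ p ∈ Subgroup.zpowers a) :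
    p = 2 ∧ x * a * x⁻¹ = a⁻¹ ∧ x ^ 2 = z ∧ 4 ∣ orderOf a := by
  have hf := Fact.mk hp
  have h1 := hG.step_one p hp hP a z hz hzc hza hN hC
  have hpa : p ∣ orderOf a := by
    rw [← hz]; exact orderOf_dvd_of_mem_zpowers hza
  obtain ⟨n, hn⟩ := IsPGroup.iff_orderOf.1 hP a
  have hc : ∀ x : G, ∃ k : ℤ, x * a * x⁻¹ = a ^ k := fun x => by
    obtain ⟨k, hk⟩ := hN.conj_mem a (Subgroup.mem_zpowers a) x
    exact ⟨k, hk.symm⟩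
  have hu : ∀ y ∈ Subgroup.zpowers a, y ^ p = 1 → y ∈ Subgroup.zpowers z := by
    intro y hy hyp
    have := unique_of_cyclic (X := Subgroup.zpowers a) p hp.pos ⟨z, hza⟩ ⟨y, hy⟩
      (by rw [← hz]; exact Subgroup.orderOf_mk _ _) (Subtype.ext hyp)
    obtain ⟨i, hi⟩ := this
    exact ⟨i, congrArg Subtype.val hi⟩
  -- general facts on elements outside the cyclic subgroup
  have hjk : ∀ y : G, ∀ k j : ℤ, y * a * y⁻¹ = a ^ k → y ^ p = a ^ j →
      (orderOf a : ℤ) ∣ j * (k - 1) := by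
    intro y k j hk hj
    have h2 := conj_mul_zpow hk j
    rw [← hj, ← pow_succ', pow_succ] at h2
    have h3 := mul_right_cancel h2
    rw [hj] at h3
    apply orderOf_dvd_iff_zpow_eq_one.2
    rw [mul_sub, mul_one, zpow_sub, mul_comm j k, ← h3, mul_inv_cancel]
  have hk1 : ∀ y : G, y ∉ Subgroup.zpowers a → ∀ k : ℤ, y * a * y⁻¹ = a ^ k →
      ¬ (orderOf a : ℤ) ∣ k - 1 := by
    intro y hy k hk hd
    apply hy
    apply hC
    have := orderOf_dvd_iff_zpow_eq_one.1 hd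
    rw [zpow_sub, zpow_one, mul_inv_eq_one] at this
    rw [this] at hk
    exact mul_inv_eq_iff_eq_mul.1 hk
  have hmemshift : ∀ (y : G) (i : ℤ), a ^ i * y ∈ Subgroup.zpowers a → y ∈ Subgroup.zpowers a := by
    intro y i h
    exact (Subgroup.mul_mem_cancel_left _ (Subgroup.zpow_mem_zpowers a i)).1 h
  obtain ⟨k, hk⟩ := hc x
  obtain ⟨j, hj⟩ := hxp
  have hj : x ^ p = a ^ j := hj.symm
  have hkp := conj_mod_p p hp hP hk hpa
  have hd := hjk x k j hk hj
  by_cases hgood : p = 2 → (4:ℤ) ∣ k - 1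
  · exfalso
    obtain ⟨s, hs, hcop⟩ := geom_good p hp k hkp hgood
    have hpj : (p:ℤ) ∣ j := by
      by_contra hpj
      apply hk1 x hx k hk
      have : IsCoprime ((orderOf a : ℕ):ℤ) j := by
        rw [hn]; push_cast
        apply IsCoprime.pow_left
        exact ((Nat.prime_iff_prime_int.1 hp).coprime_iff_not_dvd).2 hpj
      exact this.dvd_of_dvd_mul_left hd
    obtain ⟨j', rfl⟩ := hpj
    have hco : IsCoprime s ((orderOf a : ℕ):ℤ) := by
      rw [hn]; push_cast; exact hcop.pow_right
    obtain ⟨v, t, hvt⟩ := hco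
    apply hx
    apply hmemshift x (-j' * v)
    apply h1
    rw [shift_pow hk, hj, hs, ← zpow_add]
    apply orderOf_dvd_iff_zpow_eq_one.1
    refine ⟨p * j' * t, ?_⟩
    linear_combination (-(p:ℤ) * j') * hvt
  · push Not at hgood
    obtain ⟨rfl, h4⟩ := hgood
    have hn2 : 4 ∣ (orderOf a : ℕ) := by
      have : 2 ≤ n := by
        by_contra hlt
        have hn1 : n = 1 ∨ n = 0 := by omega
        apply hk1 x hx k hk
        rw [hn]
        rcases hn1 with rfl | rfl
        · simpa using hkp
        · simp
      rw [hn]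
      exact pow_dvd_pow 2 this
    have hzz : ∀ y ∈ Subgroup.zpowers z, y = 1 ∨ y = z := by
      have hz2 : z ^ (2:ℤ) = 1 := by
        have := pow_orderOf_eq_one z
        rw [hz] at this
        exact_mod_cast this
      rintro y ⟨i, rfl⟩
      rcases Int.even_or_odd' i with ⟨j, rfl | rfl⟩
      · left
        simp [zpow_mul, hz2]
      · right
        simp [zpow_mul, zpow_add, hz2]
    have hsq : ∀ y : G, y ∉ Subgroup.zpowers a → y * a * y⁻¹ = a ^ k → y ^ 2 ∈ Subgroup.zpowers a →
        y ^ 2 = z := by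
      intro y hy hyk hy2
      obtain ⟨i, hi⟩ := hy2
      have hi : y ^ 2 = a ^ i := hi.symm
      have h5 := hjk y k i hyk hi
      obtain ⟨d, hd⟩ : ∃ c, k = 4 * c + 3 := ⟨(k - 3) / 4, by push_cast at hkp; omega⟩
      have h6 : (orderOf a : ℤ) ∣ i * 2 := by
        have h7 : IsCoprime ((orderOf a : ℕ):ℤ) (2 * d + 1) := by
          rw [hn]; push_cast
          apply IsCoprime.pow_left
          exact ⟨-d, 1, by ring⟩
        apply h7.dvd_of_dvd_mul_right
        rw [hd] at h5
        have e : i * 2 * (2 * d + 1) = i * (4 * d + 3 - 1) := by ring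
        rw [e]; exact h5
      have h8 : (y ^ 2) ^ 2 = 1 := by
        rw [hi, ← zpow_natCast, ← zpow_mul]
        exact orderOf_dvd_iff_zpow_eq_one.1 (by exact_mod_cast h6)
      rcases hzz _ (hu (y ^ 2) (by rw [hi]; exact Subgroup.zpow_mem_zpowers a i) h8) with h9 | h9
      · exact absurd (h1 y h9) hy
      · exact h9
    have hx2 := hsq x hx hk (by rw [hj]; exact Subgroup.zpow_mem_zpowers a j)
    have hsh := shift_pow hk 1 2
    have hax := hsq (a ^ (1:ℤ) * x) (fun h => hx (hmemshift x 1 h))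
      (by
        have : a ^ (1:ℤ) * x * a * (a ^ (1:ℤ) * x)⁻¹ = a * (x * a * x⁻¹) * a⁻¹ := by group
        rw [this, hk]; group)
      (by rw [hsh]; exact Subgroup.mul_mem _ (Subgroup.zpow_mem_zpowers a _) (by rw [hj]; exact Subgroup.zpow_mem_zpowers a j))
    rw [hsh, hx2] at hax
    have h10 : a ^ (1 * ∑ j ∈ Finset.range 2, k ^ j) = 1 := by
      exact mul_eq_right.1 hax
    refine ⟨rfl, ?_, hx2, hn2⟩
    rw [hk]
    simp [Finset.sum_range_succ, zpow_add] at h10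
    exact (inv_eq_of_mul_eq_one_right h10).symm

theorem GoodT2.step_three {G : Type u} [Group G] [Finite G] (hG : GoodT2 G) (p : ℕ) (hp : p.Prime)
    (hP : IsPGroup p G) (a z : G) (hz : orderOf z = p) (hzc : ∀ g, g * z = z * g)
    (hza : z ∈ Subgroup.zpowers a) (hN : (Subgroup.zpowers a).Normal)
    (hC : ∀ x, x * a = a * x → x ∈ Subgroup.zpowers a) (y : G) (hy : y ∉ Subgroup.zpowers a) :
    p = 2 ∧ y * a * y⁻¹ = a⁻¹ ∧ y ^ 2 = z ∧ 4 ∣ orderOf a := by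
  obtain ⟨s, hs1, hs2⟩ := exists_pow_step p hP _ y hy
  have h := hG.step_two p hp hP a z hz hzc hza hN hC _ hs1 hs2
  rcases s with _ | s
  · simpa using h
  · exfalso
    obtain ⟨rfl, h2, -, h4⟩ := h
    obtain ⟨l, hl⟩ := hN.conj_mem a (Subgroup.mem_zpowers a) (y ^ 2 ^ s)
    have h5 := conj_pow_pow hl.symm 2
    rw [← pow_mul, ← pow_succ, h2] at h5
    have h6 : a ^ (l ^ 2 + 1) = 1 := by rw [zpow_add, ← h5]; simp
    have h7 := orderOf_dvd_iff_zpow_eq_one.2 h6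
    have h8 : (4:ℤ) ∣ l ^ 2 + 1 := dvd_trans (by exact_mod_cast h4) h7
    rcases Int.even_or_odd' l with ⟨c, rfl | rfl⟩
    · ring_nf at h8; omega
    · ring_nf at h8; omega

theorem quat_equiv {G : Type u} [Group G] [Finite G] (a x : G) (n : ℕ) (hn : orderOf a = 2 * n)
    (hx : x ∉ Subgroup.zpowers a) (hxa : x * a * x⁻¹ = a⁻¹) (hx2 : x ^ 2 = a ^ n)
    (hs : ∀ g, g ∈ Subgroup.zpowers a ∨ x⁻¹ * g ∈ Subgroup.zpowers a) :
    Nonempty (G ≃* QuaternionGroup n) := by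
  let φ₀ : ZMod (2 * n) →+ Additive G := ZMod.lift (2 * n)
    ⟨(zmultiplesHom (Additive G)) (Additive.ofMul a), by
      simp [← ofMul_zpow]
      have := pow_orderOf_eq_one a
      rw [hn] at this
      exact_mod_cast this⟩
  let φ : ZMod (2 * n) → G := fun i => (φ₀ i).toMul
  have hφ : ∀ i : ℤ, φ (i : ZMod (2 * n)) = a ^ i := by
    intro i
    simp only [φ, φ₀, ZMod.lift_coe]
    simp
  have hadd : ∀ i j, φ (i + j) = φ i * φ j := by
    intro i j; simp [φ]
  have hc : ∀ i, φ (-i) * x = x * φ i := by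
    intro i
    obtain ⟨i, rfl⟩ := ZMod.intCast_surjective i
    rw [← Int.cast_neg, hφ, hφ]
    have : x * a * x⁻¹ = a ^ (-1:ℤ) := by simpa using hxa
    rw [conj_mul_zpow this]; simp
  have hc2 : ∀ i, φ i * x = x * φ (-i) := by
    intro i
    have := hc (-i)
    rwa [neg_neg] at this
  have hnn : φ (n : ZMod (2 * n)) = x * x := by
    have := hφ n
    rw [← sq, hx2]
    simpa using this
  let f : QuaternionGroup n →* G := MonoidHom.mk' (fun q => match q with
    | .a i => φ i
    | .xa i => x * φ i) (by
      rintro (i | i) (j | j)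
      · simp [hadd]
      · simp only [QuaternionGroup.a_mul_xa]
        rw [← mul_assoc, hc2, sub_eq_add_neg, add_comm, hadd, mul_assoc]
      · simp [hadd, mul_assoc]
      · simp only [QuaternionGroup.xa_mul_xa]
        have : (n : ZMod (2 * n)) + j - i = n + (-i + j) := by ring
        rw [this, hadd, hadd, hnn]
        calc x * x * (φ (-i) * φ j) = x * (x * φ (-i)) * φ j := by group
          _ = x * φ i * (x * φ j) := by rw [← hc2]; group)
  refine ⟨(MulEquiv.ofBijective f ⟨?_, ?_⟩).symm⟩
  · rw [injective_iff_map_eq_one]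
    rintro (i | i) hi
    · have hi : φ i = 1 := hi
      obtain ⟨i, rfl⟩ := ZMod.intCast_surjective i
      rw [hφ] at hi
      have := orderOf_dvd_iff_zpow_eq_one.2 hi
      rw [hn] at this
      rw [QuaternionGroup.one_def]
      congr 1
      exact (ZMod.intCast_zmod_eq_zero_iff_dvd _ _).2 this
    · exfalso
      have hi : x * φ i = 1 := hi
      obtain ⟨i, rfl⟩ := ZMod.intCast_surjective i
      rw [hφ] at hi
      apply hx
      rw [mul_eq_one_iff_eq_inv.1 hi]
      exact Subgroup.inv_mem _ (Subgroup.zpow_mem_zpowers a i)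
  · intro g
    rcases hs g with ⟨i, hi⟩ | ⟨i, hi⟩
    · exact ⟨.a i, (hφ i).trans hi⟩
    · refine ⟨.xa i, ?_⟩
      show x * φ i = g
      rw [hφ]
      have hi : a ^ i = x⁻¹ * g := hi
      rw [hi]; group

theorem GoodT2.pgroup {G : Type u} [Group G] [Finite G] (hG : GoodT2 G) (p : ℕ) (hp : p.Prime)
    (hP : IsPGroup p G) : IsCyclic G ∨
      (p = 2 ∧ ∃ m, 1 ≤ m ∧ Nonempty (G ≃* QuaternionGroup (2 ^ m))) := by
  have hf := Fact.mk hp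
  rcases subsingleton_or_nontrivial G with hsub | hnt
  · left; infer_instance
  obtain ⟨a, z, hz, hzc, hza, hN, hC⟩ := hG.exists_struct p hp hP
  have h3 := hG.step_three p hp hP a z hz hzc hza hN hC
  by_cases hall : ∀ y, y ∈ Subgroup.zpowers a
  · exact Or.inl ⟨a, hall⟩
  right
  push Not at hall
  obtain ⟨x, hx⟩ := hall
  obtain ⟨rfl, hxa, hx2, h4⟩ := h3 x hx
  refine ⟨rfl, ?_⟩
  obtain ⟨n, hn⟩ := IsPGroup.iff_orderOf.1 hP a
  have hn2 : 2 ≤ n := by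
    by_contra hlt
    rw [hn] at h4
    have : n = 0 ∨ n = 1 := by omega
    rcases this with rfl | rfl <;> norm_num at h4
  obtain ⟨m, rfl⟩ : ∃ m, n = m + 1 := ⟨n - 1, by omega⟩
  refine ⟨m, by omega, ?_⟩
  apply quat_equiv a x (2 ^ m) (by rw [hn]; ring) hx hxa
  · rw [hx2]
    have ho : orderOf (a ^ 2 ^ m) = 2 := by
      rw [orderOf_pow, hn, pow_succ, Nat.gcd_eq_right (Dvd.intro _ rfl)]
      exact Nat.mul_div_cancel_left _ (by positivity)
    have := unique_of_cyclic (X := Subgroup.zpowers a) 2 (by norm_num)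
      ⟨a ^ 2 ^ m, Subgroup.npow_mem_zpowers a _⟩ ⟨z, hza⟩
      ((Subgroup.orderOf_mk _ _).trans ho)
      (Subtype.ext (by have := pow_orderOf_eq_one z; rw [hz] at this; exact this))
    obtain ⟨i, hi⟩ := this
    have hi : (a ^ 2 ^ m) ^ i = z := congrArg Subtype.val hi
    have hs2 : (a ^ 2 ^ m) ^ (2:ℤ) = 1 := by
      have := pow_orderOf_eq_one (a ^ 2 ^ m)
      rw [ho] at this
      exact_mod_cast this
    rcases Int.even_or_odd' i with ⟨c, rfl | rfl⟩
    · rw [zpow_mul, hs2, one_zpow] at hi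
      rw [← hi, orderOf_one] at hz
      omega
    · rw [zpow_add, zpow_mul, hs2, one_zpow, one_mul, zpow_one] at hi
      exact hi.symm
  · intro g
    by_cases hg : g ∈ Subgroup.zpowers a
    · exact Or.inl hg
    · right
      apply hC
      obtain ⟨-, hga, -, -⟩ := h3 g hg
      have h5 : x⁻¹ * a⁻¹ * x = a := by rw [← hxa]; group
      have h6 : x⁻¹ * g * a = x⁻¹ * (g * a * g⁻¹) * x * (x⁻¹ * g) := by group
      rw [h6, hga, h5]

theorem GoodT2.sylow {G : Type u} [Group G] [Finite G] [Group.IsSolvable G] (hG : GoodT2 G) (p : ℕ) [hp : Fact p.Prime]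
    (P : Sylow p G) : IsCyclic P ∨ (p = 2 ∧ ∃ m, 1 ≤ m ∧ Nonempty (P ≃* QuaternionGroup (2 ^ m))) := by
  obtain ⟨K, hN, hK, ⟨e⟩⟩ := hG.split p P
  exact GoodT2.pgroup (GoodT2.fst (hG.congr e.symm)) p hp.out P.2

theorem GoodT2.nilpotent {G : Type u} [Group G] [Finite G] [Group.IsSolvable G] (hG : GoodT2 G) :
    Group.IsNilpotent G := by
  have ht : Group.IsNilpotent G ↔ ∀ (p : ℕ) (_hp : Fact p.Prime) (P : Sylow p G), (P : Subgroup G).Normal :=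
    (Group.isNilpotent_of_finite_tfae (G := G)).out 0 3
  rw [ht]
  intro p hp P
  obtain ⟨K, hN, hK, ⟨e⟩⟩ := hG.split p P
  exact hN

theorem GoodT2.cyclic_or {G : Type u} [Group G] [Finite G] [Group.IsSolvable G] (hG : GoodT2 G)
    (h : ∀ P : Sylow 2 G, IsCyclic P) : IsCyclic G := by
  have := hG.nilpotent
  have : IsZGroup G := ⟨fun p hp P => by
    have := Fact.mk hp
    rcases hG.sylow p P with h1 | ⟨rfl, -⟩
    · exact h1
    · exact h P⟩
  infer_instance

theorem soluble_main
    (G : Type u) [Group G] [Finite G] [Group.IsSolvable G] :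
    IsTotally2Closed.{u,v} G ↔
      (IsCyclic G ∨ ∃ n m : ℕ, Odd n ∧ 1 ≤ m ∧
        Nonempty (G ≃* (Multiplicative (ZMod n) × QuaternionGroup (2 ^ m)))) := by
  constructor
  · intro h
    have hG := goodT2_of_t2c h
    by_cases hc : ∀ P : Sylow 2 G, IsCyclic P
    · exact Or.inl (hG.cyclic_or hc)
    · right
      push Not at hc
      obtain ⟨P, hP⟩ := hc
      rcases hG.sylow 2 P with h1 | ⟨-, m, hm, ⟨f⟩⟩
      · exact absurd h1 hP
      obtain ⟨K, hN, hK, ⟨e⟩⟩ := hG.split 2 P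
      have hKG : GoodT2 K := GoodT2.fst (hG.congr (e.symm.trans MulEquiv.prodComm))
      have hKc : IsCyclic K := by
        apply hKG.cyclic_or
        intro Q
        have : Nat.card Q = 1 := by
          obtain ⟨r, hr⟩ := IsPGroup.iff_card.1 Q.2
          rcases r with _ | r
          · simpa using hr
          · exfalso
            apply hK
            have h1 := Subgroup.card_subgroup_dvd_card (Q : Subgroup K)
            refine dvd_trans ?_ h1
            exact ⟨2 ^ r, by rw [← pow_succ']; exact hr⟩
        have := (Nat.card_eq_one_iff_unique.1 this).1
        infer_instance
      refine ⟨Nat.card K, m, ?_, hm, ⟨?_⟩⟩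
      · rw [← Nat.not_even_iff_odd, even_iff_two_dvd]; exact hK
      · exact (e.symm.trans MulEquiv.prodComm).trans
          (MulEquiv.prodCongr (zmodCyclicMulEquiv hKc).symm f)
  · rintro (h | ⟨n, m, hn, hm, ⟨e⟩⟩)
    · exact t2c_of_cyclic
    · exact t2c_of_quat n m hn e

theorem soluble_totally_two_closed_classification
    (G : Type*) [Group G] [Finite G] [Group.IsSolvable G] :
    IsTotally2Closed G ↔
      (IsCyclic G ∨ ∃ n m : ℕ, Odd n ∧ 1 ≤ m ∧
        Nonempty (G ≃* (Multiplicative (ZMod n) × QuaternionGroup (2 ^ m)))) := by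
  exact soluble_main G
end

section
/- Every finite soluble totally 2-closed group is nilpotent. -/
universe u v w in
theorem t2c_transfer {G : Type u} [Group G] (h : IsTotally2Closed.{u, v} G) {α : Type w} [Finite α]
    (φ : G →* Equiv.Perm α) (hφ : Function.Injective φ) (θ : Equiv.Perm α)
    (hθ : ∀ a b, ∃ g, θ a = φ g a ∧ θ b = φ g b) : ∃ g, θ = φ g := by
  have hs : Small.{v} α := Countable.toSmall.{v} α
  let e : α ≃ Shrink.{v} α := @equivShrink.{v} α hs
  let E : Equiv.Perm α ≃* Equiv.Perm (Shrink.{v} α) := e.permCongrHom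
  let ψ : G →* Equiv.Perm (Shrink.{v} α) := E.toMonoidHom.comp φ
  have hψ : Function.Injective ψ := E.injective.comp hφ
  have hc := h (Shrink.{v} α) ψ.range ⟨MonoidHom.ofInjective hψ⟩
  have hm : E θ ∈ twoClosure ψ.range := by
    intro a b
    obtain ⟨g, h1, h2⟩ := hθ (e.symm a) (e.symm b)
    refine ⟨ψ g, ⟨g, rfl⟩, ?_, ?_⟩
    · change e (θ (e.symm a)) = e (φ g (e.symm a))
      rw [h1]
    · change e (θ (e.symm b)) = e (φ g (e.symm b))
      rw [h2]
  rw [hc] at hm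
  obtain ⟨g, hg⟩ := hm
  exact ⟨g, (E.injective hg).symm⟩

theorem t2c_normal {G : Type*} [Group G] [Finite G] (h : IsTotally2Closed G)
    (N R : Subgroup G) [N.Normal] (hRN : (R ⊔ N).Normal)
    (hco : Disjoint R N) : R.Normal := by
  let φ : G →* Equiv.Perm ((G ⧸ R) ⊕ (G ⧸ N)) :=
    (Equiv.Perm.sumCongrHom _ _).comp
      ((MulAction.toPermHom G (G ⧸ R)).prod (MulAction.toPermHom G (G ⧸ N)))
  have e1 : ∀ g (a : G), φ g (Sum.inl (a : G ⧸ R)) = Sum.inl ((g * a : G) : G ⧸ R) :=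
    fun g a => rfl
  have e2 : ∀ g (a : G), φ g (Sum.inr (a : G ⧸ N)) = Sum.inr ((g * a : G) : G ⧸ N) :=
    fun g a => rfl
  have hφ : Function.Injective φ := by
    rw [injective_iff_map_eq_one]
    intro g hg
    have h1 := e1 g 1
    have h2 := e2 g 1
    rw [hg] at h1 h2
    simp only [Equiv.Perm.one_apply, Sum.inl.injEq, Sum.inr.injEq, QuotientGroup.eq] at h1 h2
    simp only [inv_one, one_mul, mul_one] at h1 h2
    exact Subgroup.disjoint_def.mp hco h1 h2
  -- every element of `R` is in the core of `R`
  have key : ∀ x ∈ R, ∀ a : G, a⁻¹ * x * a ∈ R := by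
    intro x hx
    let θ : Equiv.Perm ((G ⧸ R) ⊕ (G ⧸ N)) :=
      Equiv.Perm.sumCongr 1 (MulAction.toPermHom G (G ⧸ N) x)
    have t1 : ∀ a : G, θ (Sum.inl (a : G ⧸ R)) = Sum.inl (a : G ⧸ R) := fun a => rfl
    have t2 : ∀ a : G, θ (Sum.inr (a : G ⧸ N)) = Sum.inr ((x * a : G) : G ⧸ N) := fun a => rfl
    have mix : ∀ a b : G, ∃ g, θ (Sum.inl (a : G ⧸ R)) = φ g (Sum.inl (a : G ⧸ R)) ∧
        θ (Sum.inr (b : G ⧸ N)) = φ g (Sum.inr (b : G ⧸ N)) := by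
      intro a b
      have hm : a⁻¹ * x * a ∈ R ⊔ N := by
        have := hRN.conj_mem x (Subgroup.mem_sup_left hx) a⁻¹
        simpa using this
      obtain ⟨r, hr, n, hn, hrn⟩ := Subgroup.mem_sup_of_normal_right.mp hm
      refine ⟨a * r * a⁻¹, ?_, ?_⟩
      · rw [t1, e1, Sum.inl.injEq, QuotientGroup.eq]
        simpa [mul_assoc] using hr
      · rw [t2, e2, Sum.inr.injEq, QuotientGroup.eq]
        have hxx : x = a * (r * n) * a⁻¹ := by rw [hrn]; group
        have : (x * b)⁻¹ * (a * r * a⁻¹ * b) = (b⁻¹ * a) * n⁻¹ * (b⁻¹ * a)⁻¹ := by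
          rw [hxx]; group
        rw [this]
        exact Subgroup.Normal.conj_mem inferInstance _ (N.inv_mem hn) _
    have hθ : ∀ a b, ∃ g, θ a = φ g a ∧ θ b = φ g b := by
      rintro (a | a) (b | b) <;> induction a using QuotientGroup.induction_on <;>
        induction b using QuotientGroup.induction_on
      · exact ⟨1, by rw [t1, e1, one_mul], by rw [t1, e1, one_mul]⟩
      · exact mix _ _
      · obtain ⟨g, h1, h2⟩ := mix _ _
        exact ⟨g, h2, h1⟩
      · exact ⟨x, by rw [t2, e2], by rw [t2, e2]⟩
    obtain ⟨k, hk⟩ := t2c_transfer h φ hφ θ hθ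
    have hkR : ∀ a : G, a⁻¹ * k * a ∈ R := by
      intro a
      have := t1 a
      rw [hk, e1, Sum.inl.injEq, eq_comm, QuotientGroup.eq] at this
      simpa [mul_assoc] using this
    have hkN : k⁻¹ * x ∈ N := by
      have := t2 1
      rw [hk, e2, Sum.inr.injEq, QuotientGroup.eq] at this
      simpa using this
    have hk' : k ∈ R := by simpa using hkR 1
    have := Subgroup.disjoint_def.mp hco (R.mul_mem (R.inv_mem hk') hx) hkN
    have hxk : k = x := by rwa [inv_mul_eq_one] at this
    exact hxk ▸ hkR
  refine ⟨fun x hx a => ?_⟩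
  simpa using key x hx a⁻¹

/-- A nontrivial finite soluble group has a nontrivial normal `r`-subgroup. -/
theorem exists_normal_pgroup_s1 {Q : Type*} [Group Q] [Finite Q] [Group.IsSolvable Q] [Nontrivial Q] :
    ∃ (r : ℕ) (_ : Fact r.Prime) (A : Subgroup Q), A.Normal ∧ IsPGroup r A ∧ A ≠ ⊥ := by
  obtain ⟨n, hn⟩ : ∃ n, derivedSeries Q n = ⊥ := (Group.isSolvable_def Q).mp inferInstance
  classical
  have hex : ∃ n, derivedSeries Q n = ⊥ := ⟨n, hn⟩
  obtain ⟨m, hm⟩ : ∃ m, Nat.find hex = m + 1 := by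
    refine Nat.exists_eq_succ_of_ne_zero fun h0 => ?_
    have := Nat.find_spec hex
    rw [h0, derivedSeries_zero] at this
    exact top_ne_bot this
  have hB : derivedSeries Q m ≠ ⊥ := Nat.find_min hex (by omega)
  have hB' : ⁅derivedSeries Q m, derivedSeries Q m⁆ = ⊥ := by
    rw [← derivedSeries_succ, ← hm]; exact Nat.find_spec hex
  set B := derivedSeries Q m with hBdef
  have hBn : B.Normal := derivedSeries_normal Q m
  have hcomm : ∀ a b : B, a * b = b * a := by
    intro a b
    have := Subgroup.commutator_mem_commutator a.2 b.2
    rw [hB', Subgroup.mem_bot] at this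
    exact Subtype.ext (commutatorElement_eq_one_iff_mul_comm.mp this)
  have hcard : Nat.card B ≠ 1 := fun hc => hB (Subgroup.card_eq_one.mp hc)
  obtain ⟨r, hr, hrd⟩ := Nat.exists_prime_and_dvd hcard
  have : Fact r.Prime := ⟨hr⟩
  let S : Sylow r B := default
  have hSn : (S : Subgroup B).Normal := ⟨fun x hx a => by rw [hcomm a x]; simpa using hx⟩
  have := Sylow.characteristic_of_normal S hSn
  refine ⟨r, ⟨hr⟩, (S : Subgroup B).map B.subtype, inferInstance, S.isPGroup'.map _, ?_⟩
  intro hbot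
  rw [Subgroup.map_eq_bot_iff_of_injective _ B.subtype_injective] at hbot
  exact S.ne_bot_of_dvd_card hrd hbot

theorem soluble_totally_two_closed_isNilpotent
    (G : Type*) [Group G] [Finite G] [Group.IsSolvable G]
    (h : IsTotally2Closed G) : Group.IsNilpotent G := by
  classical
  obtain ⟨F, ⟨hFn, hFnil⟩, hFmax⟩ :=
    (Set.toFinite {F : Subgroup G | F.Normal ∧ Group.IsNilpotent F}).exists_maximal
      ⟨⊥, inferInstance, inferInstance⟩
  by_cases hFt : F = ⊤
  · subst hFt
    exact Group.nilpotent_of_surjective (Subgroup.topEquiv (G := G)).toMonoidHom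
      Subgroup.topEquiv.surjective
  exfalso
  have : Nontrivial (G ⧸ F) := QuotientGroup.nontrivial_iff.mpr hFt
  obtain ⟨r, hr, A, hAn, hAp, hA⟩ := exists_normal_pgroup_s1 (Q := G ⧸ F)
  let M := A.comap (QuotientGroup.mk' F)
  have hMn : M.Normal := hAn.comap _
  have hFM : F ≤ M := fun x hx => by
    change (x : G ⧸ F) ∈ A
    rw [(QuotientGroup.eq_one_iff x).mpr hx]; exact A.one_mem
  -- the r'-part of F
  obtain ⟨N, ⟨hNn, hNF, hNr⟩, hNmax⟩ :=
    (Set.toFinite {N : Subgroup G | N.Normal ∧ N ≤ F ∧ (Nat.card N).Coprime r}).exists_maximal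
      ⟨⊥, inferInstance, bot_le, by simp⟩
  have hFNidx : ∃ k, N.relIndex F = r ^ k := by
    refine ⟨_, Nat.eq_prime_pow_of_unique_prime_dvd (p := r) (Subgroup.index_ne_zero_of_finite (H := N.subgroupOf F)) ?_⟩
    intro d hd hdvd
    by_contra hdr
    have : Fact d.Prime := ⟨hd⟩
    let S : Sylow d F := default
    have hSn : (S : Subgroup F).Normal := inferInstance
    have := Sylow.characteristic_of_normal S hSn
    let T : Subgroup G := (S : Subgroup F).map F.subtype
    have hTn : T.Normal := inferInstanceAs ((S : Subgroup F).map F.subtype).Normal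
    have hTp : IsPGroup d T := S.isPGroup'.map _
    have hTF : T ≤ F := Subgroup.map_subtype_le _
    have hTr : (Nat.card T).Coprime r := by
      obtain ⟨j, hj⟩ := IsPGroup.iff_card.mp hTp
      rw [hj]
      exact Nat.Coprime.pow_left _ ((Nat.coprime_primes hd hr.out).mpr hdr)
    have hTN : (Nat.card (T ⊔ N : Subgroup G)).Coprime r := by
      have h1 := Subgroup.relIndex_mul_relIndex ⊥ N (T ⊔ N) bot_le le_sup_right
      rw [Subgroup.relIndex_bot_left, Subgroup.relIndex_bot_left,
        Subgroup.relIndex_sup_right] at h1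
      rw [← h1]
      exact Nat.Coprime.mul_left hNr (hTr.coprime_dvd_left (Subgroup.relIndex_dvd_card _ _))
    have hle : T ≤ N := le_sup_left.trans
      (hNmax ⟨Subgroup.sup_normal T N, sup_le hTF hNF, hTN⟩ le_sup_right)
    have hd2 : d ∣ T.relIndex F := hdvd.trans (Subgroup.relIndex_dvd_of_le_left F hle)
    have hTi : T.relIndex F = (S : Subgroup F).index := by
      rw [Subgroup.relIndex, Subgroup.subgroupOf,
        Subgroup.comap_map_eq_self_of_injective F.subtype_injective]
    rw [hTi] at hd2
    exact S.not_dvd_index hd2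
  have hMidx : ∃ k, N.relIndex M = r ^ k := by
    obtain ⟨k, hk⟩ := hFNidx
    obtain ⟨l, hl⟩ := IsPGroup.iff_card.mp hAp
    refine ⟨k + l, ?_⟩
    rw [← Subgroup.relIndex_mul_relIndex N F M hNF hFM, hk, pow_add]
    congr 1
    rw [← hl]
    have h1 := Subgroup.relIndex_ker M (QuotientGroup.mk' F)
    rw [QuotientGroup.ker_mk', Subgroup.map_comap_eq_self_of_surjective
      (QuotientGroup.mk'_surjective F)] at h1
    exact h1
  obtain ⟨k, hk⟩ := hMidx
  let S : Sylow r M := default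
  let R : Subgroup G := (S : Subgroup M).map M.subtype
  have hRp : IsPGroup r R := S.isPGroup'.map _
  have hRM : R ≤ M := Subgroup.map_subtype_le _
  have hdisj : Disjoint R N := by
    obtain ⟨j, hj⟩ := IsPGroup.iff_card.mp hRp
    apply Subgroup.disjoint_of_coprime_natCard
    rw [hj]
    exact Nat.Coprime.pow_left _ hNr.symm
  have hsup : R ⊔ N = M := by
    refine le_antisymm (sup_le hRM (hNF.trans hFM)) ?_
    rw [← Subgroup.relIndex_eq_one]
    have h1 : (R ⊔ N).relIndex M ∣ r ^ k := hk ▸ Subgroup.relIndex_dvd_of_le_left M le_sup_right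
    have h2 : (R ⊔ N).relIndex M ∣ (S : Subgroup M).index := by
      have hTi : R.relIndex M = (S : Subgroup M).index := by
        rw [Subgroup.relIndex, Subgroup.subgroupOf,
          Subgroup.comap_map_eq_self_of_injective M.subtype_injective]
      exact hTi ▸ Subgroup.relIndex_dvd_of_le_left M le_sup_left
    exact Nat.eq_one_of_dvd_coprimes
      (Nat.Coprime.pow_left k ((Nat.Prime.coprime_iff_not_dvd hr.out).mpr S.not_dvd_index)) h1 h2
  have hRn : R.Normal := t2c_normal h N R (hsup ▸ hMn) hdisj
  have hMnil : Group.IsNilpotent M := by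
    have c : ∀ (x : R) (y : N), Commute (R.subtype x) (N.subtype y) := fun x y =>
      Subgroup.commute_of_normal_of_disjoint R N hRn hNn hdisj x y x.2 y.2
    have hRnil : Group.IsNilpotent R := hRp.isNilpotent
    have hNnil : Group.IsNilpotent N :=
      Group.nilpotent_of_surjective (Subgroup.subgroupOfEquivOfLe hNF).toMonoidHom
        (Subgroup.subgroupOfEquivOfLe hNF).surjective
    let f := MonoidHom.noncommCoprod R.subtype N.subtype c
    have hf : f.range = M := by
      rw [MonoidHom.noncommCoprod_range, Subgroup.range_subtype, Subgroup.range_subtype, hsup]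
    rw [← hf]
    exact Group.nilpotent_of_surjective f.rangeRestrict f.rangeRestrict_surjective
  have hle : M ≤ F := hFmax ⟨hMn, hMnil⟩ hFM
  apply hA
  rw [eq_bot_iff]
  intro x hx
  induction x using QuotientGroup.induction_on with
  | H x =>
    rw [Subgroup.mem_bot, QuotientGroup.eq_one_iff]
    exact hle hx
end
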